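/- arXiv:1501.07711 — 5 statements merged into one kernel-verified Lean document; each statement's English description precedes it below -/
import Mathlib

section
/- Let m be a natural number, let p₁,…,p_m ∈ ℂ be pairwise distinct, let h₁,…,h_m ∈ ℂ be pairwise distinct, and let t, k, ν ∈ ℂ. Assume p_a + h_b − 1 ≠ 0 for all a,b, t − h_b + ν ≠ 0 for all b, and k − p_a − ν ≠ 0 for all a. Then 1 + Σ_{a=1}^{m} Σ_{b=1}^{m} [ (t + k − 1) / ((p_a + h_b − 1)(t − h_b + ν)(k − p_a − ν)) ] · [ ∏_{c=1}^{m} (h_c + p_a − 1)(h_b + p_c − 1) ] / [ ∏_{c≠a} (p_c − p_a) · ∏_{c≠b} (h_c − h_b) ] = ∏_{c=1}^{m} [ (h_c + k − ν − 1)(t + ν + p_c − 1) ] / [ (p_c − k + ν)(h_c − t − ν) ]. -/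
open Finset

section Interpolation

variable {ι F : Type*} [Fintype ι] [DecidableEq ι] [Field F]

/-- Lagrange interpolation in evaluated form. -/
theorem eval_eq_sum_eval_mul_prod_div {v : ι → F} (hv : Function.Injective v)
    {f : Polynomial F} (hf : f.degree < Fintype.card ι) (x : F) :
    f.eval x = ∑ i, f.eval (v i) * ∏ j ∈ univ.erase i, (x - v j) / (v i - v j) := by
  conv_lhs => rw [Lagrange.eq_interpolate (s := univ) (v := v) hv.injOn hf]
  simp only [Lagrange.interpolate_apply, Polynomial.eval_finsetSum, Polynomial.eval_mul,
    Polynomial.eval_C, Lagrange.basis, Polynomial.eval_prod, Lagrange.basisDivisor,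
    Polynomial.eval_sub, Polynomial.eval_X, div_eq_inv_mul]

theorem prod_erase_sub_eq_sum {q : ι → F} (hq : Function.Injective q) (p : ι → F) (a : ι)
    (x : F) :
    ∏ c ∈ univ.erase a, (x - p c) =
      ∑ b, (∏ c ∈ univ.erase a, (q b - p c)) *
        ∏ c ∈ univ.erase b, (x - q c) / (q b - q c) := by
  have hd : (Lagrange.nodal (univ.erase a) p).degree < Fintype.card ι := by
    rw [Lagrange.degree_nodal]
    exact_mod_cast card_erase_lt_of_mem (mem_univ a)
  simpa only [Lagrange.eval_nodal] using eval_eq_sum_eval_mul_prod_div hq hd x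

theorem prod_sub_eq_prod_sub_add_sum {p : ι → F} (hp : Function.Injective p) (q : ι → F)
    (x : F) :
    ∏ c, (x - q c) = ∏ c, (x - p c) +
      ∑ a, (∏ c, (p a - q c)) * ∏ c ∈ univ.erase a, (x - p c) / (p a - p c) := by
  have hd : (Lagrange.nodal univ q - Lagrange.nodal univ p).degree < Fintype.card ι := by
    have h := Polynomial.degree_sub_lt_left
      (p := Lagrange.nodal univ q) (q := Lagrange.nodal univ p)
      (by simp only [Lagrange.degree_nodal]) Lagrange.nodal_ne_zero
      (by rw [Lagrange.nodal_monic.leadingCoeff, Lagrange.nodal_monic.leadingCoeff])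
    rwa [Lagrange.degree_nodal] at h
  have h := eval_eq_sum_eval_mul_prod_div hp hd x
  simp only [Polynomial.eval_sub, Lagrange.eval_nodal_at_node (mem_univ _), sub_zero] at h
  simp only [Lagrange.eval_nodal] at h
  rw [← h]
  ring

/-- Lagrange interpolation of `∏ c, (X - q c)` at the nodes `p` together with `K`. -/
theorem prod_sub_div_mul_prod_sub_eq {p : ι → F} (hp : Function.Injective p) (q : ι → F)
    {K : F} (hK : ∀ a, K - p a ≠ 0) (T : F) :
    (∏ c, (K - q c)) / (∏ c, (K - p c)) * ∏ c, (T - p c) = ∏ c, (T - q c) -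
      ∑ a, (K - T) / (K - p a) *
        ((∏ c, (p a - q c)) * ∏ c ∈ univ.erase a, (T - p c) / (p a - p c)) := by
  have hP : ∏ c, (K - p c) ≠ 0 := prod_ne_zero_iff.2 fun a _ => hK a
  rw [prod_sub_eq_prod_sub_add_sum hp q K, prod_sub_eq_prod_sub_add_sum hp q T, add_div,
    div_self hP, add_mul, one_mul, add_sub_assoc, ← sum_sub_distrib, sum_div, sum_mul]
  congr 1
  refine sum_congr rfl fun a _ => ?_
  have hKa := hK a
  have hE : ∏ c ∈ univ.erase a, (K - p c) ≠ 0 := prod_ne_zero_iff.2 fun c _ => hK c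
  rw [← mul_prod_erase univ (fun c => K - p c) (mem_univ a),
    ← mul_prod_erase univ (fun c => T - p c) (mem_univ a), prod_div_distrib, prod_div_distrib]
  have hD : ∏ c ∈ univ.erase a, (p a - p c) ≠ 0 :=
    prod_ne_zero_iff.2 fun c hc => sub_ne_zero.2 (hp.ne (ne_of_mem_erase hc).symm)
  field_simp
  ring

/-- The double-sum identity in terms of the nodes `p` and `q` alone. -/
theorem one_add_sum_sum_eq_prod {p q : ι → F} (hp : Function.Injective p)
    (hq : Function.Injective q) {K T : F} (hpq : ∀ a b, p a - q b ≠ 0)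
    (hT : ∀ b, q b - T ≠ 0) (hK : ∀ a, K - p a ≠ 0) :
    1 + ∑ a, ∑ b, (K - T) / ((p a - q b) * (q b - T) * (K - p a)) *
        ((∏ c, (p a - q c) * (p c - q b)) /
          ((∏ c ∈ univ.erase a, (p c - p a)) * ∏ c ∈ univ.erase b, (q b - q c))) =
      ∏ c, (K - q c) * (T - p c) / ((K - p c) * (T - q c)) := by
  have hT' : ∀ b, T - q b ≠ 0 := fun b => by
    rw [← neg_sub]
    exact neg_ne_zero.2 (hT b)
  have hQ : ∏ c, (T - q c) ≠ 0 := prod_ne_zero_iff.2 fun b _ => hT' b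
  have inner (a : ι) : ∑ b, (K - T) / ((p a - q b) * (q b - T) * (K - p a)) *
        ((∏ c, (p a - q c) * (p c - q b)) /
          ((∏ c ∈ univ.erase a, (p c - p a)) * ∏ c ∈ univ.erase b, (q b - q c))) =
      -((K - T) / (K - p a) *
        ((∏ c, (p a - q c)) * ∏ c ∈ univ.erase a, (T - p c) / (p a - p c))) /
          ∏ c, (T - q c) := by
    rw [prod_div_distrib, prod_erase_sub_eq_sum hq p a T, sum_div, mul_sum, mul_sum,
      ← sum_neg_distrib, sum_div]
    refine sum_congr rfl fun b _ => ?_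
    have hflip : (∏ c ∈ univ.erase a, (p c - q b)) / ∏ c ∈ univ.erase a, (p c - p a) =
        (∏ c ∈ univ.erase a, (q b - p c)) / ∏ c ∈ univ.erase a, (p a - p c) := by
      rw [← prod_div_distrib, ← prod_div_distrib]
      refine prod_congr rfl fun c _ => ?_
      rw [← neg_sub (q b), ← neg_sub (p a), neg_div_neg_eq]
    have hE : ∏ c ∈ univ.erase b, (T - q c) ≠ 0 := prod_ne_zero_iff.2 fun c _ => hT' c
    have hD : ∏ c ∈ univ.erase b, (q b - q c) ≠ 0 :=
      prod_ne_zero_iff.2 fun c hc => sub_ne_zero.2 (hq.ne (ne_of_mem_erase hc).symm)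
    have hab := hpq a b
    have hTb := hT' b
    have hKa := hK a
    rw [prod_mul_distrib, ← mul_prod_erase univ (fun c => p c - q b) (mem_univ a),
      ← mul_prod_erase univ (fun c => T - q c) (mem_univ b), prod_div_distrib,
      ← neg_sub T (q b)]
    calc
      _ = -((K - T) / ((T - q b) * (K - p a)) * (∏ c, (p a - q c)) *
          ((∏ c ∈ univ.erase a, (p c - q b)) / ∏ c ∈ univ.erase a, (p c - p a)) /
            ∏ c ∈ univ.erase b, (q b - q c)) := by field_simp
      _ = _ := by
        rw [hflip]
        field_simp
  have key := prod_sub_div_mul_prod_sub_eq hp q hK T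
  rw [sum_congr rfl fun a _ => inner a, ← sum_div, sum_neg_distrib, prod_div_distrib,
    prod_mul_distrib, prod_mul_distrib, mul_div_mul_comm, ← mul_div_assoc, key, sub_div,
    div_self hQ, neg_div, ← sub_eq_add_neg]

end Interpolation

/-- the rational-function summation identity evaluating the
rank-one-perturbation factor `S_{t,k}`. -/
theorem stmt7 (m : ℕ) (p h : Fin m → ℂ)
    (hp : Function.Injective p) (hh : Function.Injective h)
    (t k ν : ℂ)
    (h1 : ∀ a b, p a + h b - 1 ≠ 0)
    (h2 : ∀ b, t - h b + ν ≠ 0)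
    (h3 : ∀ a, k - p a - ν ≠ 0) :
    1 + ∑ a : Fin m, ∑ b : Fin m,
      (t + k - 1) / ((p a + h b - 1) * (t - h b + ν) * (k - p a - ν)) *
        ((∏ c : Fin m, (h c + p a - 1) * (h b + p c - 1)) /
          ((∏ c ∈ Finset.univ.erase a, (p c - p a)) *
            ∏ c ∈ Finset.univ.erase b, (h c - h b)))
    = ∏ c : Fin m, (h c + k - ν - 1) * (t + ν + p c - 1) /
        ((p c - k + ν) * (h c - t - ν)) := by
  have hq : Function.Injective fun c => 1 - h c := fun a b hab => hh (sub_right_injective hab)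
  have key := one_add_sum_sum_eq_prod hp hq (K := k - ν) (T := 1 - t - ν)
    (fun a b => by convert h1 a b using 1; ring)
    (fun b => by convert h2 b using 1; ring)
    (fun a => by convert h3 a using 1; ring)
  convert key using 1
  · congr 1
    refine sum_congr rfl fun a _ => sum_congr rfl fun b _ => ?_
    congr 1
    · congr 1 <;> ring
    · congr 1
      · exact prod_congr rfl fun c _ => by ring
      · congr 1
        exact prod_congr rfl fun c _ => by ring
  · refine prod_congr rfl fun c _ => ?_
    rw [← neg_div_neg_eq]
    congr 1 <;> ring
end

section
/- Let m ≥ 1 be a natural number, let p₁,…,p_m ∈ ℂ be pairwise distinct, let h₁,…,h_m ∈ ℂ be arbitrary, fix an index a₀ ∈ {1,…,m}, and let k, ν ∈ ℂ. Assume h_{a₀} + p_q − 1 ≠ 0 and k − p_q − ν ≠ 0 for all q, and h_{a₀} + k − ν − 1 ≠ 0. Then Σ_{q=1}^{m} [ 1 / ((k − p_q − ν)(h_{a₀} + p_q − 1)) ] · [ ∏_{c=1}^{m} (h_c + p_q − 1) ] / [ ∏_{c≠q} (p_c − p_q) ] = [ −1 / (h_{a₀} + k − ν − 1) ] · ∏_{c=1}^{m}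 [ (h_c + k − ν − 1) / (p_c − k + ν) ]. -/
/-- Partial fraction form of Lagrange interpolation: a polynomial of degree less than the number
of nodes, divided by the nodal polynomial and evaluated away from the nodes. -/
theorem Polynomial.sum_eval_div_prod_sub {ι F : Type*} [DecidableEq ι] [Field F] {s : Finset ι}
    {v : ι → F} (hv : Set.InjOn v s) {f : Polynomial F} (hf : f.degree < s.card) {x : F}
    (hx : ∀ i ∈ s, x ≠ v i) :
    ∑ i ∈ s, f.eval (v i) / ((x - v i) * ∏ j ∈ s.erase i, (v j - v i)) =
      -(f.eval x / ∏ i ∈ s, (v i - x)) := by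
  have hne : ∏ i ∈ s, (v i - x) ≠ 0 :=
    Finset.prod_ne_zero_iff.2 fun i hi => sub_ne_zero.2 (hx i hi).symm
  have key := Lagrange.eval_interpolate_not_at_node (fun i => f.eval (v i)) hx
  rw [← Lagrange.eq_interpolate hv hf, Lagrange.eval_nodal] at key
  have hsign : ∏ i ∈ s, (x - v i) = (-1) ^ s.card * ∏ i ∈ s, (v i - x) := by
    rw [← Finset.prod_const, ← Finset.prod_mul_distrib]
    exact Finset.prod_congr rfl fun i _ => by ring
  rw [key, hsign, mul_right_comm, mul_div_cancel_right₀ _ hne, Finset.mul_sum,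
    ← Finset.sum_neg_distrib]
  refine Finset.sum_congr rfl fun i hi => ?_
  have hw : Lagrange.nodalWeight s v i =
      (-1) ^ (s.erase i).card * (∏ j ∈ s.erase i, (v j - v i))⁻¹ := by
    rw [Lagrange.nodalWeight, ← Finset.prod_inv_distrib, ← Finset.prod_const,
      ← Finset.prod_mul_distrib]
    refine Finset.prod_congr rfl fun j _ => ?_
    rw [← neg_sub (v j) (v i), inv_neg, neg_one_mul]
  have hpow : (-1 : F) ^ s.card * (-1) ^ (s.erase i).card = -1 := by
    rw [← Finset.card_erase_add_one hi, pow_succ, mul_right_comm, ← mul_pow]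
    simp
  rw [hw, div_eq_mul_inv, mul_inv]
  linear_combination (-(x - v i)⁻¹ * (∏ j ∈ s.erase i, (v j - v i))⁻¹ * f.eval (v i)) * -hpow

open Finset

/-- the residue-type rational summation identity evaluating `S_{n+a,b}`. -/
theorem stmt8 (m : ℕ) (hm : 1 ≤ m) (p : Fin m → ℂ) (hp : Function.Injective p)
    (h : Fin m → ℂ) (a₀ : Fin m) (k ν : ℂ)
    (h1 : ∀ q, h a₀ + p q - 1 ≠ 0)
    (h2 : ∀ q, k - p q - ν ≠ 0)
    (h3 : h a₀ + k - ν - 1 ≠ 0) :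
    ∑ q : Fin m, 1 / ((k - p q - ν) * (h a₀ + p q - 1)) *
        ((∏ c : Fin m, (h c + p q - 1)) / ∏ c ∈ Finset.univ.erase q, (p c - p q))
    = -1 / (h a₀ + k - ν - 1) * ∏ c : Fin m, (h c + k - ν - 1) / (p c - k + ν) := by
  have hdeg : (∏ c ∈ univ.erase a₀, (Polynomial.X + Polynomial.C (h c - 1))).degree
      < ((univ : Finset (Fin m)).card : WithBot ℕ) := by
    rw [Polynomial.degree_prod]
    simp only [Polynomial.degree_X_add_C, sum_const, nsmul_eq_mul, mul_one]
    exact_mod_cast card_lt_card (erase_ssubset (mem_univ a₀))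
  have key := Polynomial.sum_eval_div_prod_sub (s := univ) hp.injOn hdeg (x := k - ν)
    fun q _ hq => h2 q (by rw [← hq]; ring)
  have heval (y : ℂ) (hy : h a₀ + y - 1 ≠ 0) :
      (∏ c ∈ univ.erase a₀, (Polynomial.X + Polynomial.C (h c - 1))).eval y =
        (∏ c, (h c + y - 1)) / (h a₀ + y - 1) := by
    rw [eq_div_iff hy, ← prod_erase_mul univ _ (mem_univ a₀), Polynomial.eval_prod]
    congr 1
    refine prod_congr rfl fun c _ => ?_
    simp only [Polynomial.eval_add, Polynomial.eval_X, Polynomial.eval_C]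
    ring
  have hx : h a₀ + (k - ν) - 1 = h a₀ + k - ν - 1 := by ring
  rw [heval _ (hx ▸ h3)] at key
  convert key using 1
  · refine sum_congr rfl fun q _ => ?_
    rw [heval _ (h1 q), sub_right_comm, div_mul_div_comm, one_mul, div_div]
    congr 1
    ring
  · rw [prod_div_distrib, hx]
    simp only [← add_sub_assoc, sub_add]
    ring
end

section
/- Let n ≥ 1, let p₁,…,p_n be pairwise distinct positive integers, let h₁,…,h_n be pairwise distinct positive integers, let ν ∈ ℂ \ ℤ and let ω ∈ ℂ be nonzero. Define the n×n complex matrices N and K by N_{ab} = −(sin(πν)/π) · ω^{p_a + h_b − 1} / (p_a + h_b − 1) · Γ(p_a + ν) Γ(h_b − ν) / (Γ(p_a) Γ(h_b)) and K_{ab} = −(π/sin(πν)) · ω^{1 − p_b − h_a} · Γ(p_b) Γ(h_a) / (Γ(p_b + ν) Γ(h_a − ν)) · [1/(h_a + p_b − 1)] · [ ∏_{c=1}^{n} (h_c + p_b − 1)(h_a + p_c − 1) ] / [ ∏_{c≠b} (p_c − p_b) · ∏_{c≠a} (h_c − h_a) ]. Then N·K = Id and K·N = Id, i.e. K is the inverse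 matrix of N. -/
open Finset

/-- The matrix with entries `(x a + y b)⁻¹`. -/
def cauchyMatrix {ι F : Type*} [Field F] (x y : ι → F) : Matrix ι ι F :=
  Matrix.of fun a b => (x a + y b)⁻¹

/-- The explicit inverse of `cauchyMatrix x y`. -/
def cauchyMatrixInv {ι F : Type*} [Fintype ι] [DecidableEq ι] [Field F] (x y : ι → F) :
    Matrix ι ι F :=
  Matrix.of fun a b => 1 / (y a + x b) *
    ((∏ c, (y c + x b) * (y a + x c)) /
      ((∏ c ∈ univ.erase b, (x c - x b)) * ∏ c ∈ univ.erase a, (y c - y a)))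

/-- Lagrange interpolation of `∏ c ≠ a, (X + x c)` at the nodes `y`, evaluated at `-z`. -/
theorem prod_erase_sub_eq_sum_lagrange {ι F : Type*} [Fintype ι] [DecidableEq ι] [Field F]
    {x y : ι → F} (hy : Function.Injective y) (a : ι) (z : F) :
    ∏ c ∈ univ.erase a, (x c - z) =
      ∑ i, (∏ c ∈ univ.erase a, (y i + x c)) *
        ∏ c ∈ univ.erase i, ((y c + z) / (y c - y i)) := by
  have hdeg : (Lagrange.nodal (univ.erase a) (fun c => -x c)).degree < #(univ : Finset ι) := by
    rw [Lagrange.degree_nodal]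
    exact_mod_cast card_erase_lt_of_mem (mem_univ a)
  have key := congrArg (Polynomial.eval (-z)) (Lagrange.eq_interpolate hy.injOn hdeg)
  rw [Lagrange.interpolate_apply, Polynomial.eval_finsetSum, Lagrange.eval_nodal] at key
  calc ∏ c ∈ univ.erase a, (x c - z) = ∏ c ∈ univ.erase a, (-z - -x c) :=
        prod_congr rfl fun c _ => by ring
    _ = _ := key
    _ = _ := by
      refine sum_congr rfl fun i _ => ?_
      rw [Polynomial.eval_mul, Polynomial.eval_C, Lagrange.eval_nodal, Lagrange.basis,
        Polynomial.eval_prod]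
      congr 1
      · exact prod_congr rfl fun c _ => by ring
      · refine prod_congr rfl fun c _ => ?_
        rw [Lagrange.basisDivisor, Polynomial.eval_mul, Polynomial.eval_C, Polynomial.eval_sub,
          Polynomial.eval_X, Polynomial.eval_C, ← neg_sub (y c) (y i), inv_neg, div_eq_mul_inv]
        ring

theorem cauchyMatrix_mul_cauchyMatrixInv {ι F : Type*} [Fintype ι] [DecidableEq ι] [Field F]
    {x y : ι → F} (hx : Function.Injective x) (hy : Function.Injective y)
    (hxy : ∀ a b, x a + y b ≠ 0) :
    cauchyMatrix x y * cauchyMatrixInv x y = 1 := by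
  have hyx : ∀ a b, y a + x b ≠ 0 := fun a b => by rw [add_comm]; exact hxy b a
  ext a b
  have hterm : ∀ i, cauchyMatrix x y a i * cauchyMatrixInv x y i b =
      (∏ c ∈ univ.erase b, (x c - x b))⁻¹ * ((∏ c ∈ univ.erase a, (y i + x c)) *
        ∏ c ∈ univ.erase i, ((y c + x b) / (y c - y i))) := fun i => by
    rw [cauchyMatrix, cauchyMatrixInv, Matrix.of_apply, Matrix.of_apply, prod_mul_distrib,
      ← mul_prod_erase univ (fun c => y c + x b) (mem_univ i),
      ← mul_prod_erase univ (fun c => y i + x c) (mem_univ a), prod_div_distrib, add_comm (x a)]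
    have h1 := hyx i a
    have h2 := hyx i b
    field_simp
  rw [Matrix.mul_apply, sum_congr rfl fun i _ => hterm i, ← mul_sum,
    ← prod_erase_sub_eq_sum_lagrange hy]
  rcases eq_or_ne a b with rfl | hab
  · rw [Matrix.one_apply_eq]
    exact inv_mul_cancel₀ <| prod_ne_zero_iff.mpr fun c hc =>
      sub_ne_zero.mpr (hx.ne (ne_of_mem_erase hc))
  · rw [Matrix.one_apply_ne hab, prod_eq_zero (mem_erase.mpr ⟨hab.symm, mem_univ b⟩) (sub_self _),
      mul_zero]

/-- Rescaling rows and columns of a matrix rescales its right inverse accordingly. -/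
theorem Matrix.mul_eq_one_of_scaled {ι F : Type*} [Fintype ι] [DecidableEq ι] [Field F]
    {A B M L : Matrix ι ι F} {u v : ι → F} (hu : ∀ a, u a ≠ 0) (hv : ∀ a, v a ≠ 0)
    (hAB : A * B = 1) (hM : ∀ a b, M a b = u a * v b * A a b)
    (hL : ∀ a b, L a b = (v a)⁻¹ * (u b)⁻¹ * B a b) : M * L = 1 := by
  ext a b
  have hterm : ∀ i, M a i * L i b = u a * (u b)⁻¹ * (A a i * B i b) := fun i => by
    rw [hM, hL]
    have := hv i
    field_simp
  rw [Matrix.mul_apply, sum_congr rfl fun i _ => hterm i, ← mul_sum, ← Matrix.mul_apply, hAB]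
  rcases eq_or_ne a b with rfl | hab
  · rw [Matrix.one_apply_eq, mul_one, mul_inv_cancel₀ (hu a)]
  · rw [Matrix.one_apply_ne hab, mul_zero]

theorem Complex.sin_pi_mul_ne_zero {ν : ℂ} (hν : ∀ m : ℤ, ν ≠ m) :
    Complex.sin (Real.pi * ν) ≠ 0 := by
  rw [Complex.sin_ne_zero_iff]
  intro k hk
  rw [mul_comm] at hk
  exact hν k (mul_right_cancel₀ (Complex.ofReal_ne_zero.mpr Real.pi_ne_zero) hk)

/-- the explicit inverse of the Cauchy-type matrix `N`. -/
theorem stmt9 (n : ℕ) (hn : 1 ≤ n) (p h : Fin n → ℕ)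
    (hp0 : ∀ a, 0 < p a) (hh0 : ∀ a, 0 < h a)
    (hp : Function.Injective p) (hh : Function.Injective h)
    (ν : ℂ) (hν : ∀ m : ℤ, ν ≠ (m : ℂ)) (ω : ℂ) (hω : ω ≠ 0)
    (N K : Matrix (Fin n) (Fin n) ℂ)
    (hN : ∀ a b, N a b =
      -(Complex.sin ((Real.pi : ℂ) * ν) / (Real.pi : ℂ)) *
        ω ^ ((p a : ℤ) + (h b : ℤ) - 1) / ((p a : ℂ) + (h b : ℂ) - 1) *
        (Complex.Gamma ((p a : ℂ) + ν) * Complex.Gamma ((h b : ℂ) - ν) /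
          (Complex.Gamma ((p a : ℂ)) * Complex.Gamma ((h b : ℂ)))))
    (hK : ∀ a b, K a b =
      -((Real.pi : ℂ) / Complex.sin ((Real.pi : ℂ) * ν)) *
        ω ^ (1 - (p b : ℤ) - (h a : ℤ)) *
        (Complex.Gamma ((p b : ℂ)) * Complex.Gamma ((h a : ℂ)) /
          (Complex.Gamma ((p b : ℂ) + ν) * Complex.Gamma ((h a : ℂ) - ν))) *
        (1 / ((h a : ℂ) + (p b : ℂ) - 1)) *
        ((∏ c : Fin n, ((h c : ℂ) + (p b : ℂ) - 1) * ((h a : ℂ) + (p c : ℂ) - 1)) /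
          ((∏ c ∈ Finset.univ.erase b, ((p c : ℂ) - (p b : ℂ))) *
            ∏ c ∈ Finset.univ.erase a, ((h c : ℂ) - (h a : ℂ))))) :
    N * K = 1 ∧ K * N = 1 := by
  have hs := Complex.sin_pi_mul_ne_zero hν
  have hπ : (Real.pi : ℂ) ≠ 0 := Complex.ofReal_ne_zero.mpr Real.pi_ne_zero
  have hΓ : ∀ m : ℕ, 0 < m → Complex.Gamma m ≠ 0 := fun m hm =>
    Complex.Gamma_ne_zero_of_re_pos (by simpa using hm)
  have hΓp : ∀ m : ℕ, Complex.Gamma (m + ν) ≠ 0 := fun m =>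
    Complex.Gamma_ne_zero fun k hk => hν (-k - m) (by push_cast; linear_combination hk)
  have hΓm : ∀ m : ℕ, Complex.Gamma (m - ν) ≠ 0 := fun m =>
    Complex.Gamma_ne_zero fun k hk => hν (k + m) (by push_cast; linear_combination -hk)
  have hpos : ∀ a b, (p a : ℂ) - 1 + h b ≠ 0 := fun a b => by
    have : (p a : ℂ) - 1 + h b = ((p a - 1 + h b : ℕ) : ℂ) := by
      push_cast [Nat.cast_sub (hp0 a)]; ring
    rw [this, Nat.cast_ne_zero]
    have := hh0 b
    omega
  have hinv := cauchyMatrix_mul_cauchyMatrixInv (x := fun a => (p a : ℂ) - 1)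
    (y := fun b => (h b : ℂ)) (fun a b hab => hp (Nat.cast_injective (sub_left_injective hab)))
    (Nat.cast_injective.comp hh) hpos
  have hNK : N * K = 1 := by
    refine Matrix.mul_eq_one_of_scaled
      (u := fun a => -(Complex.sin (Real.pi * ν) / Real.pi) * ω ^ ((p a : ℤ) - 1) *
        (Complex.Gamma (p a + ν) / Complex.Gamma (p a)))
      (v := fun b => ω ^ (h b : ℤ) * (Complex.Gamma (h b - ν) / Complex.Gamma (h b)))
      (fun a => ?_) (fun b => ?_) hinv (fun a b => ?_) (fun a b => ?_)
    · exact mul_ne_zero (mul_ne_zero (neg_ne_zero.mpr (div_ne_zero hs hπ)) (zpow_ne_zero _ hω))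
        (div_ne_zero (hΓp _) (hΓ _ (hp0 a)))
    · exact mul_ne_zero (zpow_ne_zero _ hω) (div_ne_zero (hΓm _) (hΓ _ (hh0 b)))
    · rw [hN, cauchyMatrix, Matrix.of_apply, add_sub_right_comm (p a : ℤ), zpow_add₀ hω,
        add_sub_right_comm (p a : ℂ)]
      ring
    · have hexp : (1 - (p b : ℤ) - (h a : ℤ)) = -((p b : ℤ) - 1) + -(h a : ℤ) := by ring
      rw [hK, cauchyMatrixInv, Matrix.of_apply, hexp, zpow_add₀ hω, zpow_neg, zpow_neg]
      simp only [add_sub_assoc, sub_sub_sub_cancel_right, mul_inv, inv_div, inv_neg]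
      ring
  exact ⟨hNK, mul_eq_one_comm.mp hNK⟩
end

section
/- Let n, d ≥ 0, let p₁<…<p_n and h₁<…<h_n be strictly increasing tuples of positive integers, let k₁<…<k_d and t₁<…<t_d be strictly increasing tuples of positive integers, let ν ∈ ℂ \ ℤ and let ω ∈ ℂ be nonzero. Define the n×n matrix N by N_{ab} = −(sin(πν)/π) · ω^{p_a + h_b − 1} / (p_a + h_b − 1) · Γ(p_a + ν) Γ(h_b − ν) / (Γ(p_a) Γ(h_b)) and the d×d matrix M by M_{ab} = (sin(πν)/π) · ω^{1 − t_a − k_b} / (t_a + k_b − 1) · Γ(t_a + ν) Γ(k_b − ν) / (Γ(t_a) Γ(k_b)) · ∏_{c=1}^{n} [ (p_c + t_a + ν − 1)(h_c + k_b − ν − 1) ] / [ (h_c − t_a − ν)(p_c − k_b + ν) ]. Then det(N) · det(M) = F(p,h; k,t | ν, ω), where F is the explicit discrete form factor defined in the context (with n_p = n_h = n, n_k = n_t = d). -/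
open Finset

/-- The building block `D(p,h | ν, ω)` of the discrete form factor. -/
noncomputable def Dfun {np nh : ℕ} (p : Fin np → ℕ) (h : Fin nh → ℕ) (ν ω : ℂ) : ℂ :=
  (Complex.sin ((Real.pi : ℂ) * ν) / (Real.pi : ℂ)) ^ nh *
    (∏ a : Fin np, ω ^ (p a - 1) * (Complex.Gamma ((p a : ℂ) + ν) / Complex.Gamma ((p a : ℂ)))) *
    (∏ a : Fin nh, ω ^ (h a) * (Complex.Gamma ((h a : ℂ) - ν) / Complex.Gamma ((h a : ℂ)))) *
    ((∏ a : Fin np, ∏ b ∈ Finset.Iio a, ((p b : ℂ) - (p a : ℂ))) *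
        (∏ a : Fin nh, ∏ b ∈ Finset.Iio a, ((h b : ℂ) - (h a : ℂ))) /
      ∏ a : Fin np, ∏ b : Fin nh, ((p a : ℂ) + (h b : ℂ) - 1))

/-- The coupling set function `ϖ(p,h; k,t | ν)`. -/
noncomputable def varpi {np nh nk nt : ℕ} (p : Fin np → ℕ) (h : Fin nh → ℕ)
    (k : Fin nk → ℕ) (t : Fin nt → ℕ) (ν : ℂ) : ℂ :=
  (∏ a : Fin nh, (∏ b : Fin nk, (1 - (k b : ℂ) - (h a : ℂ) + ν)) /
      ∏ b : Fin nt, ((t b : ℂ) - (h a : ℂ) + ν)) *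
    ∏ a : Fin np, (∏ b : Fin nt, ((p a : ℂ) + (t b : ℂ) + ν - 1)) /
      ∏ b : Fin nk, ((p a : ℂ) - (k b : ℂ) + ν)

/-- The discrete form factor `F(p,h; k,t | ν, ω)`. -/
noncomputable def Ffun {np nh nk nt : ℕ} (p : Fin np → ℕ) (h : Fin nh → ℕ)
    (k : Fin nk → ℕ) (t : Fin nt → ℕ) (ν ω : ℂ) : ℂ :=
  (-1 : ℂ) ^ (np + nt) *
    (-1 : ℂ) ^ ((((np : ℤ) - (nh : ℤ)) * ((np : ℤ) - (nh : ℤ) + 1)) / 2) *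
    (Complex.sin ((Real.pi : ℂ) * ν) / (Real.pi : ℂ)) ^ ((np : ℤ) - (nh : ℤ)) *
    Dfun p h ν ω * Dfun k t (-ν) ω⁻¹ * varpi p h k t ν

/-- Splitting the index `0` off a product over pairs `b < a` in `Fin (n + 1)`. -/
lemma prod_prod_Iio_fin_succ {R : Type*} [CommMonoid R] {n : ℕ}
    (f : Fin (n + 1) → Fin (n + 1) → R) :
    ∏ a, ∏ b ∈ Iio a, f b a =
      (∏ a : Fin n, f 0 a.succ) * ∏ a : Fin n, ∏ b ∈ Iio a, f b.succ a.succ := by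
  have key : ∀ {m : ℕ} (g : Fin m → Fin m → R),
      ∏ a, ∏ b ∈ Iio a, g b a = ∏ a, ∏ b, if b < a then g b a else 1 := by
    intro m g
    refine prod_congr rfl fun a _ => ?_
    rw [← prod_filter]
    exact prod_congr (by ext; simp) fun _ _ => rfl
  rw [key, key fun b a => f b.succ a.succ, ← prod_mul_distrib]
  simp [Fin.prod_univ_succ]

/-- **Cauchy determinant**. -/
lemma det_cauchy {K : Type*} [Field K] :
    ∀ {n : ℕ} (x y : Fin n → K), (∀ a b, x a + y b ≠ 0) →
      (Matrix.of fun a b => (x a + y b)⁻¹).det =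
        (∏ a, ∏ b ∈ Iio a, (x b - x a)) * (∏ a, ∏ b ∈ Iio a, (y b - y a)) /
          ∏ a, ∏ b, (x a + y b)
  | 0, x, y, _ => by simp
  | n + 1, x, y, hxy => by
    have ih := det_cauchy (fun a : Fin n => x a.succ) (fun b => y b.succ)
      fun a b => hxy _ _
    let B : Matrix (Fin (n + 1)) (Fin (n + 1)) K := Matrix.of fun a b =>
      Fin.cases (x 0 + y b)⁻¹
        (fun i => (x i.succ - x 0) * (y b - y 0) /
          ((x i.succ + y b) * (x 0 + y b) * (x i.succ + y 0))) a
    have hB : (Matrix.of fun a b => (x a + y b)⁻¹).det = B.det := by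
      refine Matrix.det_eq_of_forall_row_eq_smul_add_const
        (Fin.cases 0 fun i => (x 0 + y 0) / (x i.succ + y 0)) 0 rfl fun a b => ?_
      cases a using Fin.cases with
      | zero => simp [B]
      | succ i =>
        have h1 := hxy i.succ b
        have h2 := hxy 0 b
        have h3 := hxy i.succ 0
        simp only [B, Matrix.of_apply, Fin.cases_succ, Fin.cases_zero]
        field_simp
        ring
    have hminor : (B.submatrix Fin.succ Fin.succ).det =
        (∏ i : Fin n, (x i.succ - x 0) / (x i.succ + y 0)) *
          ((∏ j : Fin n, (y j.succ - y 0) / (x 0 + y j.succ)) *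
            (Matrix.of fun a b : Fin n => (x a.succ + y b.succ)⁻¹).det) := by
      rw [← Matrix.det_mul_row, ← Matrix.det_mul_column]
      congr 1
      ext i j
      simp only [B, Matrix.submatrix_apply, Matrix.of_apply, Fin.cases_succ]
      field_simp
    have hcol : B.det = (x 0 + y 0)⁻¹ * (B.submatrix Fin.succ Fin.succ).det := by
      rw [Matrix.det_succ_column_zero, Fin.sum_univ_succ]
      simp [B]
    have hsign : ∏ i : Fin n, ((x i.succ - x 0) * (y i.succ - y 0)) =
        ∏ i : Fin n, ((x 0 - x i.succ) * (y 0 - y i.succ)) :=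
      prod_congr rfl fun i _ => by ring
    rw [prod_mul_distrib, prod_mul_distrib] at hsign
    rw [hB, hcol, hminor, ih, prod_prod_Iio_fin_succ fun b a => x b - x a,
      prod_prod_Iio_fin_succ fun b a => y b - y a, Fin.prod_univ_succ]
    simp only [Fin.prod_univ_succ (n := n), prod_mul_distrib, prod_inv_distrib,
      div_eq_mul_inv, mul_inv]
    linear_combination (∏ i : Fin n, (x i.succ + y 0))⁻¹ * (∏ i : Fin n, (x 0 + y i.succ))⁻¹ *
      (x 0 + y 0)⁻¹ * (∏ a : Fin n, ∏ b : Fin n, (x a.succ + y b.succ))⁻¹ *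
      (∏ a : Fin n, ∏ b ∈ Iio a, (x b.succ - x a.succ)) *
      (∏ a : Fin n, ∏ b ∈ Iio a, (y b.succ - y a.succ)) * hsign

/-- The determinant of a Cauchy matrix of natural nodes with scaled rows and columns. -/
lemma det_of_eq_mul_cauchy {n : ℕ} (p h : Fin n → ℕ) (hp0 : ∀ a, 0 < p a) (hh0 : ∀ a, 0 < h a)
    (u v : Fin n → ℂ) (A : Matrix (Fin n) (Fin n) ℂ)
    (hA : ∀ a b, A a b = u a * (v b * ((p a : ℂ) + (h b : ℂ) - 1)⁻¹)) :
    A.det = (∏ a, u a) * ((∏ a, v a) *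
      ((∏ a, ∏ b ∈ Iio a, ((p b : ℂ) - (p a : ℂ))) *
        (∏ a, ∏ b ∈ Iio a, ((h b : ℂ) - (h a : ℂ))) /
          ∏ a, ∏ b, ((p a : ℂ) + (h b : ℂ) - 1))) := by
  have hc := det_cauchy (fun a => (p a : ℂ)) (fun b => (h b : ℂ) - 1) fun a b => by
    have h1 := hp0 a
    have h2 := hh0 b
    have h3 : ((p a + h b - 1 : ℕ) : ℂ) ≠ 0 := Nat.cast_ne_zero.mpr (by omega)
    rw [Nat.cast_sub (by omega)] at h3
    push_cast at h3
    rwa [← add_sub_assoc]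
  simp only [← add_sub_assoc, sub_sub_sub_cancel_right] at hc
  rw [← hc, ← Matrix.det_mul_row, ← Matrix.det_mul_column]
  congr 1
  ext a b
  simp [hA]

/-- `det N · det M` equals the discrete form factor `F(p,h;k,t|ν,ω)`. -/
theorem stmt11 (n d : ℕ) (p h : Fin n → ℕ) (k t : Fin d → ℕ)
    (hpm : StrictMono p) (hhm : StrictMono h) (hkm : StrictMono k) (htm : StrictMono t)
    (hp0 : ∀ a, 0 < p a) (hh0 : ∀ a, 0 < h a) (hk0 : ∀ a, 0 < k a) (ht0 : ∀ a, 0 < t a)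
    (ν : ℂ) (hν : ∀ m : ℤ, ν ≠ (m : ℂ)) (ω : ℂ) (hω : ω ≠ 0)
    (N : Matrix (Fin n) (Fin n) ℂ) (M : Matrix (Fin d) (Fin d) ℂ)
    (hN : ∀ a b, N a b =
      -(Complex.sin ((Real.pi : ℂ) * ν) / (Real.pi : ℂ)) *
        ω ^ ((p a : ℤ) + (h b : ℤ) - 1) / ((p a : ℂ) + (h b : ℂ) - 1) *
        (Complex.Gamma ((p a : ℂ) + ν) * Complex.Gamma ((h b : ℂ) - ν) /
          (Complex.Gamma ((p a : ℂ)) * Complex.Gamma ((h b : ℂ)))))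
    (hM : ∀ a b, M a b =
      Complex.sin ((Real.pi : ℂ) * ν) / (Real.pi : ℂ) *
        ω ^ (1 - (t a : ℤ) - (k b : ℤ)) / ((t a : ℂ) + (k b : ℂ) - 1) *
        (Complex.Gamma ((t a : ℂ) + ν) * Complex.Gamma ((k b : ℂ) - ν) /
          (Complex.Gamma ((t a : ℂ)) * Complex.Gamma ((k b : ℂ)))) *
        ∏ c : Fin n, ((p c : ℂ) + (t a : ℂ) + ν - 1) * ((h c : ℂ) + (k b : ℂ) - ν - 1) /
          (((h c : ℂ) - (t a : ℂ) - ν) * ((p c : ℂ) - (k b : ℂ) + ν))) :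
    N.det * M.det = Ffun p h k t ν ω := by
  have hω' : ∀ m : ℕ, 0 < m → ω ^ (m : ℤ) = ω ^ (m - 1) * ω := fun m hm => by
    rw [zpow_natCast, ← pow_succ, Nat.sub_add_cancel hm]
  have hNdet := det_of_eq_mul_cauchy p h hp0 hh0
    (fun a => ω ^ (p a - 1) * (Complex.Gamma ((p a : ℂ) + ν) / Complex.Gamma (p a : ℂ)))
    (fun b => -(Complex.sin ((Real.pi : ℂ) * ν) / (Real.pi : ℂ)) *
      (ω ^ h b * (Complex.Gamma ((h b : ℂ) - ν) / Complex.Gamma (h b : ℂ)))) N fun a b => by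
    rw [hN, zpow_sub₀ hω, zpow_add₀ hω, hω' _ (hp0 a), zpow_natCast, zpow_one,
      mul_right_comm (ω ^ (p a - 1)), mul_div_cancel_right₀ _ hω]
    simp only [div_eq_mul_inv, mul_inv]
    ring
  have hMdet := det_of_eq_mul_cauchy t k ht0 hk0
    (fun a => ω⁻¹ ^ t a * (Complex.Gamma ((t a : ℂ) + ν) / Complex.Gamma (t a : ℂ)) *
      ∏ c : Fin n, ((p c : ℂ) + (t a : ℂ) + ν - 1) / ((h c : ℂ) - (t a : ℂ) - ν))
    (fun b => Complex.sin ((Real.pi : ℂ) * ν) / (Real.pi : ℂ) *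
      (ω⁻¹ ^ (k b - 1) * (Complex.Gamma ((k b : ℂ) - ν) / Complex.Gamma (k b : ℂ))) *
      ∏ c : Fin n, ((h c : ℂ) + (k b : ℂ) - ν - 1) / ((p c : ℂ) - (k b : ℂ) + ν)) M
    fun a b => by
    have hpow : ω ^ (1 - (t a : ℤ) - (k b : ℤ)) = ω⁻¹ ^ t a * ω⁻¹ ^ (k b - 1) := by
      rw [zpow_sub₀ hω, zpow_sub₀ hω, hω' _ (hk0 b), zpow_natCast, zpow_one, inv_pow, inv_pow]
      field_simp
    rw [hM, hpow]
    simp only [div_eq_mul_inv, mul_inv, prod_mul_distrib]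
    ring
  have hvarpi : varpi p h k t ν =
      (∏ a : Fin d, ∏ c : Fin n,
        ((p c : ℂ) + (t a : ℂ) + ν - 1) / ((h c : ℂ) - (t a : ℂ) - ν)) *
      ∏ b : Fin d, ∏ c : Fin n,
        ((h c : ℂ) + (k b : ℂ) - ν - 1) / ((p c : ℂ) - (k b : ℂ) + ν) := by
    have h1 : ∏ a : Fin n, (∏ b : Fin d, (1 - (k b : ℂ) - (h a : ℂ) + ν)) /
        ∏ b : Fin d, ((t b : ℂ) - (h a : ℂ) + ν) =
        ∏ a : Fin n, (∏ b : Fin d, ((h a : ℂ) + (k b : ℂ) - ν - 1)) /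
          ∏ b : Fin d, ((h a : ℂ) - (t b : ℂ) - ν) := by
      refine prod_congr rfl fun a _ => ?_
      have e1 : ∀ b, 1 - (k b : ℂ) - (h a : ℂ) + ν = -((h a : ℂ) + (k b : ℂ) - ν - 1) :=
        fun b => by ring
      have e2 : ∀ b, (t b : ℂ) - (h a : ℂ) + ν = -((h a : ℂ) - (t b : ℂ) - ν) :=
        fun b => by ring
      simp only [e1, e2, prod_neg]
      exact mul_div_mul_left _ _ (pow_ne_zero _ (by norm_num))
    rw [varpi, h1, prod_comm (s := (univ : Finset (Fin d))),
      prod_comm (s := (univ : Finset (Fin d)))]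
    simp only [prod_div_distrib]
    ring
  have hden : ∏ a : Fin d, ∏ b : Fin d, ((t a : ℂ) + (k b : ℂ) - 1) =
      ∏ a : Fin d, ∏ b : Fin d, ((k a : ℂ) + (t b : ℂ) - 1) := by
    rw [prod_comm]
    simp only [add_comm]
  rw [hNdet, hMdet, hden, Ffun, hvarpi, Dfun, Dfun]
  simp only [prod_mul_distrib, prod_const, card_univ, Fintype.card_fin, sub_self, zero_mul,
    EuclideanDomain.zero_div, zpow_zero, mul_neg, Complex.sin_neg, neg_div, sub_neg_eq_add,
    ← sub_eq_add_neg]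
  rw [neg_pow (Complex.sin ((Real.pi : ℂ) * ν) / (Real.pi : ℂ)) n,
    neg_pow (Complex.sin ((Real.pi : ℂ) * ν) / (Real.pi : ℂ)) d, pow_add]
  have hs : ((-1 : ℂ) ^ d) * (-1) ^ d = 1 := by rw [← mul_pow]; norm_num
  generalize (-1 : ℂ) ^ d = e at hs ⊢
  generalize Complex.sin ((Real.pi : ℂ) * ν) / (Real.pi : ℂ) = s
  refine (one_mul _).symm.trans ((congrArg₂ HMul.hMul hs.symm rfl).trans ?_)
  ring
end

section
/- Let r be a natural number, let ν ∈ ℂ \ ℤ and ω ∈ ℂ be nonzero, and let p = (p₁<…<p_{n_p}), h = (h₁<…<h_{n_h}), k = (k₁<…<k_{n_k}), t = (t₁<…<t_{n_t}) be strictly increasing tuples of positive integers. Let q = #{a : t_a ≤ r}, let t̃₁<…<t̃_{r−q} enumerate the complement of {r+1−t_a : 1 ≤ a ≤ q} in {1,…,r}, and define the r-translate (k′, t′) by k′ = (t̃₁, …, t̃_{r−q}, k₁+r, …, k_{n_k}+r) (a strictly increasing tuple of length n_k + r − q) and t′ = (t_{q+1}−r, …, t_{n_t}−r) (length n_t − q).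 Let σ_r({t_a}) be the permutation of {1,…,r} sending (1,…,r) to (r−t_q+1, …, r−t_1+1, t̃_{r−q}, …, t̃_1), with sign (−1)^{σ_r({t_a})}. Then (−1)^{σ_r({t_a}) + q(n_k+n_t−q)} · F(p,h; k′,t′ | ν, ω) = [∏_{j=0}^{r−1} Γ(1 + j − ν)] · (−1)^{r(n_k+n_h−n_p−n_t)} · ω^{−r(r−1)/2 − r(n_k−n_t)} · F(p,h; k,t | ν − r, ω), where F is the explicit discrete form factor defined in the context. -/
open Finset

theorem gamma_add_nat (z : ℂ) (n : ℕ) (hz : ∀ j < n, z + j ≠ 0) :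
    Complex.Gamma (z + n) = (∏ j ∈ range n, (z + j)) * Complex.Gamma z := by
  induction n with
  | zero => simp
  | succ n ih =>
    rw [prod_range_succ, Nat.cast_succ, ← add_assoc, Complex.Gamma_add_one _ (hz n n.lt_succ_self),
      ih fun j hj => hz j (hj.trans n.lt_succ_self)]
    ring

theorem gamma_eq_prod_mul_gamma_sub_nat (z : ℂ) (n : ℕ) (hz : ∀ j < n, z - (j + 1) ≠ 0) :
    Complex.Gamma z = (∏ j ∈ range n, (z - (j + 1))) * Complex.Gamma (z - n) := by
  induction n with
  | zero => simp
  | succ n ih =>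
    rw [prod_range_succ, ih fun j hj => hz j (hj.trans n.lt_succ_self), Nat.cast_succ]
    have := Complex.Gamma_add_one _ (hz n n.lt_succ_self)
    rw [show z - (n + 1) + 1 = z - n by ring] at this
    rw [this]
    ring

/-- The product of the differences `x b - x a` over `b < a`. -/
noncomputable def diffProd {n : ℕ} (x : Fin n → ℂ) : ℂ :=
  ∏ a, ∏ b ∈ Iio a, (x b - x a)

theorem prod_prod_Iio_comm {n : ℕ} (f : Fin n → Fin n → ℂ) :
    ∏ a, ∏ b ∈ Iio a, f b a = ∏ b, ∏ a ∈ Ioi b, f b a :=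
  prod_comm' (by simp)

theorem diffProd_split {n q m : ℕ} (hn : n = q + m) (x : Fin n → ℂ) :
    diffProd x = diffProd (fun i : Fin q => x ⟨i, by omega⟩) *
      diffProd (fun i : Fin m => x ⟨q + i, by omega⟩) *
      ∏ j : Fin m, ∏ i : Fin q, (x ⟨i, by omega⟩ - x ⟨q + j, by omega⟩) := by
  subst hn
  have key : ∀ {n : ℕ} (y : Fin n → ℂ),
      diffProd y = ∏ a, ∏ b, if b < a then y b - y a else 1 := by
    intro n y
    unfold diffProd
    refine prod_congr rfl fun a _ => ?_
    rw [← prod_filter]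
    congr 1
    ext; simp
  rw [key, key, key, Fin.prod_univ_add]
  simp only [Fin.prod_univ_add, prod_mul_distrib]
  have h1 : ∀ (a : Fin q) (b : Fin m), ¬ Fin.natAdd q b < Fin.castAdd m a := by
    intro a b; simp [Fin.lt_def]; omega
  have h2 : ∀ (a : Fin m) (b : Fin q), Fin.castAdd m b < Fin.natAdd q a := by
    intro a b; simp [Fin.lt_def]; omega
  simp only [h1, h2, if_true, if_false, prod_const_one, mul_one, Fin.natAdd_lt_natAdd_iff,
    (Fin.strictMono_castAdd m).lt_iff_lt]
  rw [mul_comm (∏ x_1 : Fin m, ∏ _ : Fin q, _), ← mul_assoc]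
  rfl

theorem diffProd_perm {n : ℕ} (x : Fin n → ℂ) (σ : Equiv.Perm (Fin n)) :
    diffProd (x ∘ σ) = ((Equiv.Perm.sign σ : ℤ) : ℂ) * diffProd x := by
  have key : ∀ y : Fin n → ℂ, diffProd y = (Matrix.vandermonde (-y)).det := by
    intro y
    rw [Matrix.det_vandermonde, diffProd, prod_prod_Iio_comm]
    refine prod_congr rfl fun _ _ => prod_congr rfl fun _ _ => ?_
    simp; ring
  rw [key, key, ← Matrix.det_permute]
  rfl

theorem diffProd_rev {n : ℕ} (x : Fin n → ℂ) :
    diffProd (fun i => x (Fin.rev i)) = ∏ a, ∏ b ∈ Ioi a, (x b - x a) := by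
  unfold diffProd
  rw [← Equiv.prod_comp Fin.revPerm]
  refine prod_congr rfl fun a _ => ?_
  refine prod_bij' (fun b _ => Fin.rev b) (fun b _ => Fin.rev b) ?_ ?_ ?_ ?_ ?_
  · intro b hb; simp only [Fin.revPerm_apply, mem_Iio, mem_Ioi, Fin.lt_def, Fin.val_rev] at *; omega
  · intro b hb; simp only [Fin.revPerm_apply, mem_Iio, mem_Ioi, Fin.lt_def, Fin.val_rev] at *; omega
  · simp
  · simp
  · simp

theorem diffProd_mul_rev {n : ℕ} (x : Fin n → ℂ) :
    diffProd x * diffProd (fun i => x (Fin.rev i)) = ∏ i, ∏ j ∈ univ.erase i, (x i - x j) := by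
  have : ∀ i : Fin n, (univ.erase i) = (Ioi i).disjUnion (Iio i)
      (disjoint_left.2 fun a h1 h2 => by simp at h1 h2; omega) := by
    intro i; ext j; simp; omega
  simp only [this, prod_disjUnion, prod_mul_distrib]
  rw [diffProd_rev, diffProd, prod_prod_Iio_comm, prod_prod_Iio_comm (fun b a => x a - x b)]

theorem diffProd_rev_nat (n : ℕ) :
    diffProd (fun i : Fin n => -((i : ℕ) + 1 : ℂ)) =
      ∏ j ∈ range n, Complex.Gamma (j + 1) := by
  unfold diffProd
  rw [← Fin.prod_univ_eq_prod_range (fun j : ℕ => Complex.Gamma ((j : ℂ) + 1))]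
  refine prod_congr rfl fun a _ => ?_
  rw [Complex.Gamma_nat_eq_factorial, ← prod_range_add_one_eq_factorial, ← prod_range_reflect]
  push_cast
  symm
  refine prod_bij' (fun b hb => ⟨b, by simp at hb; omega⟩) (fun b _ => (b : ℕ)) ?_ ?_ ?_ ?_ ?_
  · intro b hb; simpa [Fin.lt_def] using hb
  · intro b hb; have hlt := mem_Iio.1 hb; exact mem_range.2 hlt
  · intros; rfl
  · intros; rfl
  · intro b hb
    have : b < a := by simpa using hb
    rw [Nat.sub_sub, Nat.cast_sub (by omega)]
    push_cast
    ring

/-- The combinatorial facts relating `(k, t)` to its `r`-translate `(k', t')`: here `t₁` lists the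
entries of `t` that are at most `r`, `u` lists the complement of `{r + 1 - t₁ i}` in `{1, …, r}`,
and `ε` is the sign of the associated permutation of `{1, …, r}`. -/
structure IsTranslate {q m n nk nt nk' : ℕ} (r : ℕ) (t₁ : Fin q → ℕ) (u : Fin n → ℕ)
    (k : Fin nk → ℕ) (t : Fin nt → ℕ) (k' : Fin nk' → ℕ) (t' : Fin m → ℕ) (ε : ℂ) : Prop where
  card_r : r = q + n
  card_t : nt = q + m
  t₁_pos : ∀ i, 1 ≤ t₁ i
  t₁_le : ∀ i, t₁ i ≤ r
  t₁_inj : Function.Injective t₁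
  u_pos : ∀ i, 1 ≤ u i
  u_ne : ∀ j i, u j ≠ r + 1 - t₁ i
  k_pos : ∀ i, 1 ≤ k i
  t'_pos : ∀ i, 1 ≤ t' i
  prod_k : ∀ f : ℕ → ℂ, ∏ b, f (k' b) = (∏ i, f (u i)) * ∏ b, f (k b + r)
  prod_t : ∀ f : ℕ → ℂ, ∏ b, f (t b) = (∏ i, f (t₁ i)) * ∏ b, f (t' b + r)
  prod_Icc : ∀ f : ℕ → ℂ,
    (∏ i, f (r + 1 - t₁ i)) * ∏ i, f (u i) = ∏ j ∈ range r, f (j + 1)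
  diffProd_k : diffProd (fun i => (k' i : ℂ)) =
    diffProd (fun i => (u i : ℂ)) * diffProd (fun i => (k i : ℂ)) *
      ∏ j, ∏ i, ((u i : ℂ) - (k j + r))
  diffProd_t : diffProd (fun i => (t i : ℂ)) =
    diffProd (fun i => (t₁ i : ℂ)) * diffProd (fun i => (t' i : ℂ)) *
      ∏ j, ∏ i, ((t₁ i : ℂ) - (t' j + r))
  sign_sq : ε * ε = 1
  sign_mul : ε * ∏ j ∈ range r, Complex.Gamma (j + 1) =
    diffProd (fun i => (t₁ (Fin.rev i) : ℂ)) * diffProd (fun i => (u i : ℂ)) *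
      ∏ j, ∏ i, ((u j : ℂ) - (r + 1 - t₁ i))

theorem prod_range_sub_ne (c r : ℕ) (hc : c < r) :
    ∏ x ∈ range r, (if x = c then (1 : ℂ) else (x : ℂ) - c) =
      (-1) ^ c * Complex.Gamma (c + 1) * Complex.Gamma (r - c) := by
  obtain ⟨d, rfl⟩ : ∃ d, r = c + 1 + d := ⟨r - (c + 1), by omega⟩
  rw [prod_range_add, prod_range_succ, if_pos rfl, mul_one]
  rw [show ((c + 1 + d : ℕ) : ℂ) - c = d + 1 by push_cast; ring]
  rw [Complex.Gamma_nat_eq_factorial, Complex.Gamma_nat_eq_factorial]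
  congr 1
  · rw [← prod_range_add_one_eq_factorial, ← prod_range_reflect, Nat.cast_prod,
      ← card_range c, ← prod_const, card_range, ← prod_mul_distrib]
    refine prod_congr rfl fun x hx => ?_
    have := mem_range.1 hx
    rw [if_neg (by omega), Nat.sub_sub, Nat.cast_sub (by omega)]
    push_cast
    ring
  · rw [← prod_range_add_one_eq_factorial, Nat.cast_prod]
    refine prod_congr rfl fun x hx => ?_
    rw [if_neg (by omega)]
    push_cast
    ring

namespace IsTranslate

variable {q m n nk nt nk' r : ℕ} {t₁ : Fin q → ℕ} {u : Fin n → ℕ}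
    {k : Fin nk → ℕ} {t : Fin nt → ℕ} {k' : Fin nk' → ℕ} {t' : Fin m → ℕ} {ε : ℂ}

theorem cast_sub (H : IsTranslate r t₁ u k t k' t' ε) (i : Fin q) :
    ((r + 1 - t₁ i : ℕ) : ℂ) = r + 1 - t₁ i := by
  rw [Nat.cast_sub (by have := H.t₁_le i; omega)]
  push_cast
  ring

theorem prod_cross (H : IsTranslate r t₁ u k t k' t' ε) :
    (∏ j, ∏ i, ((u j : ℂ) - (r + 1 - t₁ i))) *
      (diffProd (fun i => (t₁ i : ℂ)) * diffProd (fun i => (t₁ (Fin.rev i) : ℂ))) =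
    (∏ i, (-1 : ℂ) ^ (r - t₁ i)) * (∏ i, Complex.Gamma ((r + 1 - t₁ i : ℕ) : ℂ)) *
      ∏ i, Complex.Gamma (t₁ i) := by
  rw [diffProd_mul_rev (fun i => (t₁ i : ℂ)), prod_comm, ← prod_mul_distrib, ← prod_mul_distrib,
    ← prod_mul_distrib]
  refine prod_congr rfl fun i _ => ?_
  have hi := H.t₁_le i
  have hi' := H.t₁_pos i
  have h1 := H.prod_Icc fun x => if x = r + 1 - t₁ i then 1 else (x : ℂ) - (r + 1 - t₁ i : ℕ)
  have h2 := prod_range_sub_ne (r - t₁ i) r (by omega)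
  have h3 : ∀ x, x + 1 = r + 1 - t₁ i ↔ x = r - t₁ i := by intro x; omega
  simp only [h3, H.u_ne, if_false] at h1
  rw [← mul_prod_erase univ _ (mem_univ i), if_pos rfl, one_mul] at h1
  rw [Nat.cast_sub hi] at h2
  simp only [H.cast_sub] at h1 ⊢
  rw [mul_comm] at h1
  have h4 : ∏ x ∈ univ.erase i, (if r + 1 - t₁ x = r + 1 - t₁ i then (1 : ℂ) else
      (r + 1 - t₁ x) - (r + 1 - t₁ i)) = ∏ j ∈ univ.erase i, ((t₁ i : ℂ) - t₁ j) := by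
    refine prod_congr rfl fun j hj => ?_
    rw [if_neg, sub_sub_sub_cancel_left]
    intro h
    have := H.t₁_le j
    exact (mem_erase.1 hj).1 (H.t₁_inj (by omega))
  rw [h4] at h1
  rw [h1, show (r : ℂ) + 1 - t₁ i = r - t₁ i + 1 by ring]
  rw [show (r : ℂ) - (r - t₁ i) = t₁ i by ring] at h2
  rw [← h2]
  refine prod_congr rfl fun x _ => ?_
  congr 1
  push_cast
  ring

theorem gamma_sub_ne (H : IsTranslate r t₁ u k t k' t' ε) (i : Fin q) :
    Complex.Gamma ((r + 1 - t₁ i : ℕ) : ℂ) ≠ 0 := by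
  refine Complex.Gamma_ne_zero_of_re_pos ?_
  have := H.t₁_le i
  rw [Complex.natCast_re]
  exact_mod_cast (by omega : 0 < r + 1 - t₁ i)

theorem diffProd_mul_gamma (H : IsTranslate r t₁ u k t k' t' ε) :
    diffProd (fun i => (u i : ℂ)) * (∏ i, Complex.Gamma (t₁ i)) * (∏ i, (-1 : ℂ) ^ (r - t₁ i)) =
      ε * diffProd (fun i => (t₁ i : ℂ)) * ∏ i, Complex.Gamma (u i) := by
  have h1 := H.prod_cross
  have h2 := H.sign_mul
  have h3 := H.prod_Icc fun x => Complex.Gamma x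
  push_cast at h3
  rw [← h3] at h2
  have h0 : (∏ i, Complex.Gamma ((r + 1 - t₁ i : ℕ) : ℂ)) ≠ 0 :=
    prod_ne_zero_iff.2 fun i _ => H.gamma_sub_ne i
  refine mul_left_cancel₀ h0 ?_
  linear_combination -diffProd (fun i => (u i : ℂ)) * h1 - diffProd (fun i => (t₁ i : ℂ)) * h2

theorem prod_sub_mul (H : IsTranslate r t₁ u k t k' t' ε) (b : Fin nk) :
    (∏ i, ((u i : ℂ) - (k b + r))) * ∏ i, ((k b : ℂ) + t₁ i - 1) =
      (-1) ^ n * ∏ j ∈ range r, ((k b + r : ℂ) - (j + 1)) := by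
  have h := H.prod_Icc fun x => (k b + r : ℂ) - x
  simp only [H.cast_sub] at h
  push_cast at h
  rw [← h]
  have : ∀ i, (u i : ℂ) - (k b + r) = (-1) * ((k b + r : ℂ) - u i) := by intro i; ring
  simp only [this, prod_mul_distrib, prod_const, card_univ, Fintype.card_fin]
  rw [prod_congr rfl fun i _ =>
    (by ring : (k b : ℂ) + t₁ i - 1 = (k b + r : ℂ) - (r + 1 - t₁ i))]
  ring

theorem prod_add_mul (H : IsTranslate r t₁ u k t k' t' ε) (c : Fin m) :
    (∏ i, ((u i : ℂ) + t' c - 1)) * ∏ i, ((t₁ i : ℂ) - (t' c + r)) =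
      (-1) ^ q * ∏ j ∈ range r, ((t' c : ℂ) + j) := by
  have h := H.prod_Icc fun x => (x : ℂ) + t' c - 1
  simp only [H.cast_sub] at h
  push_cast at h
  have h' : ∏ j ∈ range r, ((t' c : ℂ) + j) = ∏ j ∈ range r, ((j : ℂ) + 1 + t' c - 1) :=
    prod_congr rfl fun j _ => by ring
  rw [h', ← h]
  have : ∀ i, (t₁ i : ℂ) - (t' c + r) = (-1) * ((r + 1 - t₁ i : ℂ) + t' c - 1) := by
    intro i; ring
  simp only [this, prod_mul_distrib, prod_const, card_univ, Fintype.card_fin]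
  ring

theorem prod_pow (H : IsTranslate r t₁ u k t k' t' ε) (z : ℂ) :
    (∏ b, z ^ (k' b - 1)) * (∏ b, z ^ t' b) * z ^ (r * nt) =
      z ^ (∑ i ∈ range r, i) * z ^ (r * nk) * ((∏ b, z ^ (k b - 1)) * ∏ b, z ^ t b) := by
  rw [H.prod_k fun x => z ^ (x - 1), H.prod_t fun x => z ^ x]
  have h := H.prod_Icc fun x => z ^ (x - 1)
  simp only [Nat.add_sub_cancel] at h
  rw [← prod_pow_eq_pow_sum, ← h]
  simp only [pow_add, prod_mul_distrib, prod_const, card_univ, Fintype.card_fin, H.card_t]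
  rw [prod_congr rfl fun b _ => (show z ^ (k b + r - 1) = z ^ (k b - 1) * z ^ r by
    rw [← pow_add]; congr 1; have := H.k_pos b; omega)]
  have h1 : (∏ i, z ^ (r + 1 - t₁ i - 1)) * ∏ i, z ^ t₁ i = (z ^ r) ^ q := by
    rw [← prod_mul_distrib, prod_congr rfl fun i _ =>
      (show z ^ (r + 1 - t₁ i - 1) * z ^ t₁ i = z ^ r by
        rw [← pow_add]; congr 1; have := H.t₁_le i; omega)]
    simp
  simp only [prod_mul_distrib, prod_const, card_univ, Fintype.card_fin]
  rw [mul_add, pow_add, pow_mul, pow_mul, pow_mul, ← h1]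
  ring

end IsTranslate

theorem sin_pi_mul_sub_nat (ν : ℂ) (r : ℕ) :
    Complex.sin (Real.pi * (ν - r)) = (-1) ^ r * Complex.sin (Real.pi * ν) := by
  rw [← Complex.sin_antiperiodic.sub_nat_mul_eq]
  congr 1
  ring

theorem mem_integerComplement {ν : ℂ} (hν : ∀ j : ℤ, ν ≠ j) : ν ∈ Complex.integerComplement :=
  fun ⟨j, hj⟩ => hν j hj.symm

theorem Dfun_eq_diffProd {np nh : ℕ} (p : Fin np → ℕ) (h : Fin nh → ℕ) (ν ω : ℂ) :
    Dfun p h ν ω = (∏ a, ω ^ (p a - 1)) * (∏ a, ω ^ h a) *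
      ((Complex.sin (Real.pi * ν) / Real.pi) ^ nh *
        ((∏ a, Complex.Gamma ((p a : ℂ) + ν)) / ∏ a, Complex.Gamma (p a)) *
        ((∏ a, Complex.Gamma ((h a : ℂ) - ν)) / ∏ a, Complex.Gamma (h a)) *
        (diffProd (fun a => (p a : ℂ)) * diffProd (fun a => (h a : ℂ)) /
          ∏ a, ∏ b, ((p a : ℂ) + h b - 1))) := by
  simp only [Dfun, diffProd, prod_mul_distrib, prod_div_distrib]
  ring

/-- The field identity behind the comparison of `D(k', t')` with `D(k, t)`. -/
theorem ratio_identity {S sr s₀ s₁ s₂ sq ε E NA NU NT₁ GG NK DU QK DK NT DT VU VK X₁ V' Y₂ C D₁ QT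
    V₁ X₂ Y₁ : ℂ} {q m : ℕ} (hsr : s₀ * sr ^ (q + m) = 1) (hε : ε * ε = 1) (hE : E * E = 1)
    (hG : NA * NU = GG) (hR : NA * NT₁ * S ^ q * E = sq) (hsq : sq * sq = 1)
    (h₁ : X₁ * Y₁ = s₁ * QK) (h₂ : Y₂ * X₂ = s₂ * QT) (hs₂ : s₂ * s₂ = 1)
    (hV : VU * D₁ * E = ε * V₁ * DU) (nDU : DU ≠ 0) (nQK : QK ≠ 0)
    (nY₂ : Y₂ ≠ 0) (nD₁ : D₁ ≠ 0) (nQT : QT ≠ 0) (nY₁ : Y₁ ≠ 0) :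
    ε * (S ^ m * (NU * NK / (DU * (QK * DK))) * (NT / DT) * (VU * VK * X₁ * V' / (Y₂ * C))) =
      s₀ * sq * s₁ * s₂ * GG * ((sr * S) ^ (q + m) * (NK / DK) * (NT₁ * NT / (D₁ * (QT * DT))) *
        (VK * (V₁ * V' * X₂) / (Y₁ * C))) := by
  have e1 : VU * DU⁻¹ = ε * V₁ * E * D₁⁻¹ := by
    field_simp
    linear_combination E * hV - VU * D₁ * hE
  have e2 : X₁ * QK⁻¹ = s₁ * Y₁⁻¹ := by
    field_simp
    linear_combination h₁
  have e3 : X₂ * QT⁻¹ = s₂ * Y₂⁻¹ := by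
    field_simp
    linear_combination h₂
  have e4 : NA * NT₁ * S ^ q = sq * E := by
    linear_combination E * hR - NA * NT₁ * S ^ q * hE
  have hl : ε * (S ^ m * (NU * NK / (DU * (QK * DK))) * (NT / DT) *
      (VU * VK * X₁ * V' / (Y₂ * C))) =
      (VU * DU⁻¹) * (X₁ * QK⁻¹) *
        (ε * S ^ m * NU * NK * DK⁻¹ * NT * DT⁻¹ * VK * V' * Y₂⁻¹ * C⁻¹) := by
    ring
  have hr : s₀ * sq * s₁ * s₂ * GG * ((sr * S) ^ (q + m) * (NK / DK) *
      (NT₁ * NT / (D₁ * (QT * DT))) * (VK * (V₁ * V' * X₂) / (Y₁ * C))) =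
      (s₀ * sr ^ (q + m)) * (NA * NT₁ * S ^ q) * (X₂ * QT⁻¹) * (sq * s₁ * s₂ * NU * S ^ m * NK *
        DK⁻¹ * NT * D₁⁻¹ * DT⁻¹ * VK * V₁ * V' * Y₁⁻¹ * C⁻¹) := by
    rw [← hG, mul_pow, pow_add S]
    ring
  have hl' : (ε * V₁ * E * D₁⁻¹) * (s₁ * Y₁⁻¹) *
      (ε * S ^ m * NU * NK * DK⁻¹ * NT * DT⁻¹ * VK * V' * Y₂⁻¹ * C⁻¹) =
      (ε * ε) * (V₁ * E * D₁⁻¹ * s₁ * Y₁⁻¹ * S ^ m * NU * NK * DK⁻¹ * NT * DT⁻¹ * VK * V' *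
        Y₂⁻¹ * C⁻¹) := by
    ring
  have hr' : 1 * (sq * E) * (s₂ * Y₂⁻¹) * (sq * s₁ * s₂ * NU * S ^ m * NK *
        DK⁻¹ * NT * D₁⁻¹ * DT⁻¹ * VK * V₁ * V' * Y₁⁻¹ * C⁻¹) =
      (sq * sq) * (s₂ * s₂) * (V₁ * E * D₁⁻¹ * s₁ * Y₁⁻¹ * S ^ m * NU * NK * DK⁻¹ * NT * DT⁻¹ *
        VK * V' * Y₂⁻¹ * C⁻¹) := by
    ring
  rw [hl, hr, e1, e2, e3, e4, hsr, hl', hr', hε, hsq, hs₂]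
  simp only [one_mul]

theorem gamma_mul_gamma_reflect {ν : ℂ} (hν : ∀ j : ℤ, ν ≠ j) (a : ℕ) :
    Complex.Gamma (a - ν) * Complex.Gamma (1 - (a - ν)) *
      (Complex.sin (Real.pi * -ν) / Real.pi) = (-1) ^ a := by
  have hs := sin_pi_mul_ne_zero (mem_integerComplement hν)
  have hpi : (Real.pi : ℂ) ≠ 0 := Complex.ofReal_ne_zero.2 Real.pi_ne_zero
  have h1 := sin_pi_mul_sub_nat (ν := -ν + a) a
  rw [add_sub_cancel_right] at h1
  rw [Complex.Gamma_mul_Gamma_one_sub, h1, show (a : ℂ) - ν = -ν + a by ring]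
  have h2 : Complex.sin (Real.pi * (-ν + a)) ≠ 0 := by
    intro h
    rw [h, mul_zero, mul_neg, Complex.sin_neg, neg_eq_zero] at h1
    exact hs h1
  field_simp

theorem Dfun_sub_nat {np nh : ℕ} (p : Fin np → ℕ) (h : Fin nh → ℕ) (r : ℕ) {ν : ℂ} (ω : ℂ)
    (hν : ∀ j : ℤ, ν ≠ j) :
    Dfun p h ν ω * ∏ a, ∏ j ∈ range r, ((h a : ℂ) - ν + j) =
      (-1) ^ (r * nh) * Dfun p h (ν - r) ω * ∏ a, ∏ j ∈ range r, ((p a : ℂ) + ν - (j + 1)) := by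
  have hp : ∀ a, Complex.Gamma ((p a : ℂ) + ν) =
      (∏ j ∈ range r, ((p a : ℂ) + ν - (j + 1))) * Complex.Gamma ((p a : ℂ) + (ν - r)) := by
    intro a
    rw [gamma_eq_prod_mul_gamma_sub_nat _ r, add_sub_assoc]
    intro j _ h0
    exact hν (j + 1 - p a) (by push_cast; linear_combination h0)
  have hh : ∀ a, Complex.Gamma ((h a : ℂ) - (ν - r)) =
      (∏ j ∈ range r, ((h a : ℂ) - ν + j)) * Complex.Gamma ((h a : ℂ) - ν) := by
    intro a
    rw [← sub_add, gamma_add_nat _ r]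
    intro j _ h0
    exact hν (h a + j) (by push_cast; linear_combination -h0)
  unfold Dfun
  simp only [hp, hh, sin_pi_mul_sub_nat, mul_div_assoc, prod_mul_distrib, mul_pow, ← pow_mul]
  have h1 : ((-1 : ℂ) ^ (r * nh)) * (-1) ^ (r * nh) = 1 := by
    rw [← mul_pow]; simp
  linear_combination (-(Complex.sin (Real.pi * ν) / Real.pi) ^ nh *
    ((∏ a, ω ^ (p a - 1)) * ((∏ a, ∏ j ∈ range r, ((p a : ℂ) + ν - (j + 1))) *
      ∏ a, Complex.Gamma ((p a : ℂ) + (ν - r)) / Complex.Gamma (p a))) *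
    ((∏ a, ω ^ (h a)) * ((∏ a, ∏ j ∈ range r, ((h a : ℂ) - ν + j)) *
      ∏ a, Complex.Gamma ((h a : ℂ) - ν) / Complex.Gamma (h a))) *
    ((∏ a : Fin np, ∏ b ∈ Finset.Iio a, ((p b : ℂ) - (p a : ℂ))) *
        ((∏ a : Fin nh, ∏ b ∈ Finset.Iio a, ((h b : ℂ) - (h a : ℂ))) /
      ∏ a : Fin np, ∏ b : Fin nh, ((p a : ℂ) + (h b : ℂ) - 1)))) * h1

namespace IsTranslate

variable {q m n nk nt nk' r : ℕ} {t₁ : Fin q → ℕ} {u : Fin n → ℕ}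
    {k : Fin nk → ℕ} {t : Fin nt → ℕ} {k' : Fin nk' → ℕ} {t' : Fin m → ℕ} {ε : ℂ}

theorem varpi_eq (H : IsTranslate r t₁ u k t k' t' ε) {np nh : ℕ} (p : Fin np → ℕ)
    (h : Fin nh → ℕ) {ν : ℂ} (hν : ∀ j : ℤ, ν ≠ j) :
    varpi p h k' t' ν * ∏ a, ∏ j ∈ range r, ((p a : ℂ) + ν - (j + 1)) =
      (-1) ^ (r * nh) * varpi p h k t (ν - r) * ∏ a, ∏ j ∈ range r, ((h a : ℂ) - ν + j) := by
  have hh : ∀ a, (∏ b, (1 - (k' b : ℂ) - (h a : ℂ) + ν)) / ∏ b, ((t' b : ℂ) - (h a : ℂ) + ν) =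
      (-1) ^ r * ((∏ b, (1 - (k b : ℂ) - (h a : ℂ) + (ν - r))) /
        ∏ b, ((t b : ℂ) - (h a : ℂ) + (ν - r))) * ∏ j ∈ range r, ((h a : ℂ) - ν + j) := by
    intro a
    have h1 := H.prod_Icc fun x => 1 - (x : ℂ) - h a + ν
    simp only [H.cast_sub] at h1
    have h2 : ∏ j ∈ range r, (1 - ((j + 1 : ℕ) : ℂ) - h a + ν) =
        (-1) ^ r * ∏ j ∈ range r, ((h a : ℂ) - ν + j) := by
      conv_rhs => rw [← card_range r, ← prod_const, card_range, ← prod_mul_distrib]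
      exact prod_congr rfl fun j _ => by push_cast; ring
    rw [h2] at h1
    rw [H.prod_k fun x => 1 - (x : ℂ) - h a + ν, H.prod_t fun x => (x : ℂ) - h a + (ν - r)]
    have h3 : ∏ i, ((t₁ i : ℂ) - h a + (ν - r)) ≠ 0 := prod_ne_zero_iff.2 fun i _ h0 =>
      hν (h a + r - t₁ i) (by push_cast; linear_combination h0)
    have h4 : ∏ i, (1 - ((r : ℂ) + 1 - t₁ i) - h a + ν) = ∏ i, ((t₁ i : ℂ) - h a + (ν - r)) :=
      prod_congr rfl fun i _ => by ring
    have h5 : ∏ b, (1 - ((k b + r : ℕ) : ℂ) - h a + ν) = ∏ b, (1 - (k b : ℂ) - h a + (ν - r)) :=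
      prod_congr rfl fun i _ => by push_cast; ring
    have h6 : ∏ b, (((t' b + r : ℕ) : ℂ) - h a + (ν - r)) = ∏ b, ((t' b : ℂ) - h a + ν) :=
      prod_congr rfl fun i _ => by push_cast; ring
    have h7 : ∏ b, ((t' b : ℂ) - h a + ν) ≠ 0 := prod_ne_zero_iff.2 fun i _ h0 =>
      hν (h a - t' i) (by push_cast; linear_combination h0)
    rw [h4] at h1
    rw [h5, h6]
    field_simp
    linear_combination (∏ b, (1 - (k b : ℂ) - h a + (ν - r))) * h1
  have hp : ∀ a, (∏ b, ((p a : ℂ) + (t' b : ℂ) + ν - 1)) / (∏ b, ((p a : ℂ) - (k' b : ℂ) + ν)) *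
      ∏ j ∈ range r, ((p a : ℂ) + ν - (j + 1)) =
      (∏ b, ((p a : ℂ) + (t b : ℂ) + (ν - r) - 1)) /
        ∏ b, ((p a : ℂ) - (k b : ℂ) + (ν - r)) := by
    intro a
    have h1 := H.prod_Icc fun x => (p a : ℂ) - x + ν
    simp only [H.cast_sub] at h1
    have h2 : ∏ j ∈ range r, ((p a : ℂ) - ((j + 1 : ℕ) : ℂ) + ν) =
        ∏ j ∈ range r, ((p a : ℂ) + ν - (j + 1)) :=
      prod_congr rfl fun j _ => by push_cast; ring
    rw [h2] at h1
    rw [H.prod_k fun x => (p a : ℂ) - x + ν, H.prod_t fun x => (p a : ℂ) + x + (ν - r) - 1]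
    have h3 : ∏ i, ((p a : ℂ) - u i + ν) ≠ 0 := prod_ne_zero_iff.2 fun i _ h0 =>
      hν (u i - p a) (by push_cast; linear_combination h0)
    have h4 : ∏ i, ((p a : ℂ) - ((r : ℂ) + 1 - t₁ i) + ν) =
        ∏ i, ((p a : ℂ) + t₁ i + (ν - r) - 1) :=
      prod_congr rfl fun i _ => by ring
    have h5 : ∏ b, ((p a : ℂ) - ((k b + r : ℕ) : ℂ) + ν) = ∏ b, ((p a : ℂ) - k b + (ν - r)) :=
      prod_congr rfl fun i _ => by push_cast; ring
    have h6 : ∏ b, ((p a : ℂ) + ((t' b + r : ℕ) : ℂ) + (ν - r) - 1) =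
        ∏ b, ((p a : ℂ) + t' b + ν - 1) :=
      prod_congr rfl fun i _ => by push_cast; ring
    have h7 : ∏ b, ((p a : ℂ) - k b + (ν - r)) ≠ 0 := prod_ne_zero_iff.2 fun i _ h0 =>
      hν (k i - p a + r) (by push_cast; linear_combination h0)
    rw [h4] at h1
    rw [h5, h6]
    field_simp
    linear_combination -(∏ b, ((p a : ℂ) + t' b + ν - 1)) * h1
  unfold varpi
  simp only [hh, ← hp, prod_mul_distrib, prod_const, card_univ, Fintype.card_fin, ← pow_mul]
  ring

theorem Dfun_eq (H : IsTranslate r t₁ u k t k' t' ε) {ν : ℂ} (hν : ∀ j : ℤ, ν ≠ j) (z : ℂ) :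
    ε * Dfun k' t' (-ν) z * z ^ (r * nt) =
      (-1) ^ (r * (q + m) + q + nk * n + q * m) * (∏ j ∈ range r, Complex.Gamma (1 + j - ν)) *
        (z ^ (∑ i ∈ range r, i) * z ^ (r * nk)) * Dfun k t (-(ν - r)) z := by
  have hpow := H.prod_pow z
  have hS : Complex.sin (Real.pi * -(ν - r)) / Real.pi =
      (-1) ^ r * (Complex.sin (Real.pi * -ν) / Real.pi) := by
    rw [mul_neg, Complex.sin_neg, sin_pi_mul_sub_nat, mul_neg, Complex.sin_neg]
    ring
  have hG : (∏ i, Complex.Gamma ((r + 1 - t₁ i : ℕ) - ν)) * ∏ i, Complex.Gamma (u i + -ν) =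
      ∏ j ∈ range r, Complex.Gamma (1 + j - ν) := by
    have := H.prod_Icc fun x => Complex.Gamma (x - ν)
    simp only [← sub_eq_add_neg]
    rw [this]
    exact prod_congr rfl fun j _ => by push_cast; rw [add_comm (j : ℂ)]
  have hR : (∏ i, Complex.Gamma ((r + 1 - t₁ i : ℕ) - ν)) *
      (∏ i, Complex.Gamma (t₁ i - -(ν - r))) * (Complex.sin (Real.pi * -ν) / Real.pi) ^ q *
      (∏ i, (-1 : ℂ) ^ (r - t₁ i)) = (-1) ^ q := by
    have hc : ∀ x : ℂ, x ^ q = ∏ _i : Fin q, x := fun x => by simp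
    rw [hc, hc, ← prod_mul_distrib, ← prod_mul_distrib, ← prod_mul_distrib]
    refine prod_congr rfl fun i _ => ?_
    have := gamma_mul_gamma_reflect hν (r + 1 - t₁ i)
    rw [H.cast_sub] at this ⊢
    rw [show (1 : ℂ) - (r + 1 - t₁ i - ν) = t₁ i - -(ν - r) by ring] at this
    rw [this, show r + 1 - t₁ i = r - t₁ i + 1 by have := H.t₁_le i; omega, pow_succ,
      mul_right_comm, ← mul_pow]
    simp
  have hdk : ∏ b, Complex.Gamma ((k b + r : ℕ) : ℂ) =
      (∏ b, ∏ j ∈ range r, ((k b + r : ℂ) - (j + 1))) * ∏ b, Complex.Gamma (k b) := by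
    rw [← prod_mul_distrib]
    refine prod_congr rfl fun b _ => ?_
    push_cast
    rw [gamma_eq_prod_mul_gamma_sub_nat _ r, add_sub_cancel_right]
    intro j hj h0
    have := H.k_pos b
    have h1 : ((k b + r : ℕ) : ℂ) = (j + 1 : ℕ) := by push_cast; linear_combination h0
    have := Nat.cast_injective h1
    omega
  have hdt : ∏ b, Complex.Gamma ((t' b + r : ℕ) : ℂ) =
      (∏ b, ∏ j ∈ range r, ((t' b : ℂ) + j)) * ∏ b, Complex.Gamma (t' b) := by
    rw [← prod_mul_distrib]
    refine prod_congr rfl fun b _ => ?_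
    push_cast
    rw [gamma_add_nat _ r]
    intro j _ h0
    have := H.t'_pos b
    have h1 : ((t' b + j : ℕ) : ℂ) = (0 : ℕ) := by push_cast; linear_combination h0
    have := Nat.cast_injective h1
    omega
  have hX1 : (∏ b, ∏ i, ((u i : ℂ) - (k b + r))) * (∏ b, ∏ i, ((k b : ℂ) + t₁ i - 1)) =
      (-1) ^ (nk * n) * ∏ b, ∏ j ∈ range r, ((k b + r : ℂ) - (j + 1)) := by
    rw [← prod_mul_distrib, prod_congr rfl fun b _ => H.prod_sub_mul b, prod_mul_distrib]
    simp [← pow_mul, mul_comm]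
  have hX2 : (∏ i, ∏ c, ((u i : ℂ) + t' c - 1)) * (∏ c, ∏ i, ((t₁ i : ℂ) - (t' c + r))) =
      (-1) ^ (q * m) * ∏ b, ∏ j ∈ range r, ((t' b : ℂ) + j) := by
    rw [prod_comm, ← prod_mul_distrib, prod_congr rfl fun b _ => H.prod_add_mul b,
      prod_mul_distrib]
    simp [← pow_mul]
  have hKL := H.diffProd_mul_gamma
  have hVk := H.diffProd_k
  have hVt := H.diffProd_t
  have gpos : ∀ x : ℕ, 1 ≤ x → Complex.Gamma x ≠ 0 := fun x hx =>
    Complex.Gamma_ne_zero_of_re_pos (by rw [Complex.natCast_re]; exact_mod_cast hx)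
  have cpos : ∀ x y : ℕ, 1 ≤ x → 1 ≤ y → (x : ℂ) + y - 1 ≠ 0 := fun x y hx hy h0 => by
    have h1 : ((x + y : ℕ) : ℂ) = (1 : ℕ) := by push_cast; linear_combination h0
    have := Nat.cast_injective h1
    omega
  have n1 : ∏ i, Complex.Gamma (u i) ≠ 0 := prod_ne_zero_iff.2 fun i _ => gpos _ (H.u_pos i)
  have n4 : ∏ i, Complex.Gamma (t₁ i) ≠ 0 := prod_ne_zero_iff.2 fun i _ => gpos _ (H.t₁_pos i)
  have n5 : ∏ b, ∏ i, ((k b : ℂ) + t₁ i - 1) ≠ 0 := prod_ne_zero_iff.2 fun b _ =>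
    prod_ne_zero_iff.2 fun i _ => cpos _ _ (H.k_pos b) (H.t₁_pos i)
  have n6 : ∏ i, ∏ c, ((u i : ℂ) + t' c - 1) ≠ 0 := prod_ne_zero_iff.2 fun b _ =>
    prod_ne_zero_iff.2 fun i _ => cpos _ _ (H.u_pos b) (H.t'_pos i)
  have n8 : ∏ b, Complex.Gamma ((k b + r : ℕ) : ℂ) ≠ 0 :=
    prod_ne_zero_iff.2 fun i _ => gpos _ (by have := H.k_pos i; omega)
  have n9 : ∏ b, Complex.Gamma ((t' b + r : ℕ) : ℂ) ≠ 0 :=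
    prod_ne_zero_iff.2 fun i _ => gpos _ (by have := H.t'_pos i; omega)
  rw [hdk] at n8
  rw [hdt] at n9
  have n8' := left_ne_zero_of_mul n8
  have n9' := left_ne_zero_of_mul n9
  have e1 : ∏ b, Complex.Gamma (((k b + r : ℕ) : ℂ) + -ν) =
      ∏ b, Complex.Gamma ((k b : ℂ) + -(ν - r)) :=
    prod_congr rfl fun b _ => by congr 1; push_cast; ring
  have e2 : ∏ b, Complex.Gamma (((t' b + r : ℕ) : ℂ) - -(ν - r)) =
      ∏ b, Complex.Gamma ((t' b : ℂ) - -ν) :=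
    prod_congr rfl fun b _ => by congr 1; push_cast; ring
  have e3 : ∏ b, ∏ c, (((k b + r : ℕ) : ℂ) + t' c - 1) =
      ∏ b, ∏ c, ((k b : ℂ) + ((t' c + r : ℕ) : ℂ) - 1) :=
    prod_congr rfl fun b _ => prod_congr rfl fun c _ => by push_cast; ring
  have hsgn : ∀ j : ℕ, ((-1 : ℂ) ^ j) * (-1) ^ j = 1 := fun j => by rw [← mul_pow]; simp
  have hE : (∏ i, (-1 : ℂ) ^ (r - t₁ i)) * (∏ i, (-1 : ℂ) ^ (r - t₁ i)) = 1 := by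
    rw [← prod_mul_distrib]
    exact prod_eq_one fun i _ => hsgn _
  have hsr : (-1 : ℂ) ^ (r * (q + m)) * ((-1) ^ r) ^ (q + m) = 1 := by
    rw [← pow_mul, hsgn]
  have key := ratio_identity (m := m) (NK := ∏ b, Complex.Gamma ((k b : ℂ) + -(ν - r)))
    (NT := ∏ b, Complex.Gamma ((t' b : ℂ) - -ν))
    (VK := diffProd (fun i => (k i : ℂ))) (V' := diffProd (fun i => (t' i : ℂ)))
    (DK := ∏ b, Complex.Gamma (k b)) (DT := ∏ b, Complex.Gamma (t' b))
    (C := ∏ b, ∏ c, ((k b : ℂ) + ((t' c + r : ℕ) : ℂ) - 1))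
    hsr H.sign_sq hE hG hR (hsgn q) hX1 hX2 (hsgn _) hKL n1 n8' n6 n4 n9' n5
  rw [Dfun_eq_diffProd, Dfun_eq_diffProd, hVk, hVt, hS,
    H.prod_k fun x => Complex.Gamma (x + -ν), H.prod_k fun x => Complex.Gamma x,
    H.prod_t fun x => Complex.Gamma (x - -(ν - r)), H.prod_t fun x => Complex.Gamma x,
    hdk, hdt, e1, e2, H.prod_k fun x => ∏ c, ((x : ℂ) + t' c - 1), e3,
    prod_congr rfl fun b _ => H.prod_t fun x => (k b : ℂ) + x - 1, prod_mul_distrib,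
    show ∀ e a w v : ℂ, e * (a * w) * v = (e * w) * (a * v) from fun _ _ _ _ => by ring]
  rw [← H.card_t] at key ⊢
  rw [key, hpow, pow_add, pow_add, pow_add]
  ring

theorem Ffun_eq (H : IsTranslate r t₁ u k t k' t' ε) {np nh : ℕ} (p : Fin np → ℕ)
    (h : Fin nh → ℕ) {ν ω : ℂ} (hν : ∀ j : ℤ, ν ≠ j) (hω : ω ≠ 0) :
    ε * (-1 : ℂ) ^ (q * (nk + m)) * Ffun p h k' t' ν ω =
      (∏ j ∈ range r, Complex.Gamma (1 + (j : ℂ) - ν)) *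
        (-1 : ℂ) ^ ((r : ℤ) * ((nk : ℤ) + (nh : ℤ) - (np : ℤ) - (nt : ℤ))) *
        ω ^ (-(((r : ℤ) * ((r : ℤ) - 1)) / 2) - (r : ℤ) * ((nk : ℤ) - (nt : ℤ))) *
        Ffun p h k t (ν - (r : ℂ)) ω := by
  have hD := Dfun_sub_nat p h r ω hν
  have hv := H.varpi_eq p h hν
  have hD' := H.Dfun_eq hν ω⁻¹
  have hsgn : ∀ j : ℕ, ((-1 : ℂ) ^ j) * (-1) ^ j = 1 := fun j => by rw [← mul_pow]; simp
  have hPP : ∏ a, ∏ j ∈ range r, ((p a : ℂ) + ν - (j + 1)) ≠ 0 :=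
    prod_ne_zero_iff.2 fun a _ => prod_ne_zero_iff.2 fun j _ h0 =>
      hν (j + 1 - p a) (by push_cast; linear_combination h0)
  have hHH : ∏ a, ∏ j ∈ range r, ((h a : ℂ) - ν + j) ≠ 0 :=
    prod_ne_zero_iff.2 fun a _ => prod_ne_zero_iff.2 fun j _ h0 =>
      hν (h a + j) (by push_cast; linear_combination -h0)
  have hDv : Dfun p h ν ω * varpi p h k' t' ν =
      Dfun p h (ν - r) ω * varpi p h k t (ν - r) := by
    refine mul_right_cancel₀ (mul_ne_zero hHH hPP) ?_
    rw [mul_mul_mul_comm, hD, hv]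
    linear_combination (Dfun p h (ν - r) ω * varpi p h k t (ν - r) *
      (∏ a, ∏ j ∈ range r, ((h a : ℂ) - ν + j)) *
      (∏ a, ∏ j ∈ range r, ((p a : ℂ) + ν - (j + 1)))) * hsgn (r * nh)
  have hdiv : ((r : ℤ) * ((r : ℤ) - 1)) / 2 = ((∑ i ∈ range r, i : ℕ) : ℤ) := by
    refine Int.ediv_eq_of_eq_mul_left two_ne_zero ?_
    have h2 := sum_range_id_mul_two r
    rcases r with _ | r
    · simp
    · rw [Nat.add_sub_cancel] at h2
      have h3 : (((∑ i ∈ range (r + 1), i : ℕ) : ℤ)) * 2 = ((r + 1 : ℕ) : ℤ) * r := by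
        exact_mod_cast h2
      rw [h3]
      push_cast
      ring
  have hω' : ω⁻¹ ^ (∑ i ∈ range r, i) * ω⁻¹ ^ (r * nk) =
      ω ^ (-(((r : ℤ) * ((r : ℤ) - 1)) / 2) - (r : ℤ) * ((nk : ℤ) - (nt : ℤ))) *
        ω⁻¹ ^ (r * nt) := by
    rw [hdiv]
    have hi : ∀ j : ℕ, ω⁻¹ ^ j = ω ^ (-(j : ℤ)) := fun j => by
      rw [zpow_neg, zpow_natCast, inv_pow]
    rw [hi, hi, hi, ← zpow_add₀ hω, ← zpow_add₀ hω]
    congr 1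
    push_cast
    ring
  rw [hω'] at hD'
  have hz : ω⁻¹ ^ (r * nt) ≠ 0 := pow_ne_zero _ (inv_ne_zero hω)
  have hD'' : ε * Dfun k' t' (-ν) ω⁻¹ = (-1) ^ (r * (q + m) + q + nk * n + q * m) *
      (∏ j ∈ range r, Complex.Gamma (1 + j - ν)) *
      ω ^ (-(((r : ℤ) * ((r : ℤ) - 1)) / 2) - (r : ℤ) * ((nk : ℤ) - (nt : ℤ))) *
        Dfun k t (-(ν - r)) ω⁻¹ := by
    refine mul_right_cancel₀ hz ?_
    rw [hD']
    ring
  have he : ((-1 : ℂ) ^ r) ≠ 0 := pow_ne_zero _ (by norm_num)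
  have hS : (Complex.sin (Real.pi * (ν - r)) / Real.pi) ^ ((np : ℤ) - nh) =
      ((-1 : ℂ) ^ r) ^ ((np : ℤ) - nh) *
        (Complex.sin (Real.pi * ν) / Real.pi) ^ ((np : ℤ) - nh) := by
    rw [sin_pi_mul_sub_nat, mul_div_assoc, mul_zpow]
  have hs : (-1 : ℂ) ^ ((r : ℤ) * ((nk : ℤ) + (nh : ℤ) - (np : ℤ) - (nt : ℤ))) *
      ((-1 : ℂ) ^ r) ^ ((np : ℤ) - nh) = (-1) ^ (r * nk + r * (q + m)) := by
    have h1 : ((-1 : ℂ) ^ r) ^ nt * ((-1 : ℂ) ^ r) ^ nt = 1 := by rw [← mul_pow, hsgn, one_pow]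
    rw [zpow_mul, zpow_natCast, ← zpow_add₀ he,
      show (nk : ℤ) + nh - np - nt + (np - nh) = nk - nt by ring, zpow_sub₀ he, zpow_natCast,
      zpow_natCast, ← H.card_t, pow_add, pow_mul, pow_mul, div_eq_iff (pow_ne_zero _ he),
      mul_assoc, h1, mul_one]
  have hpar : (-1 : ℂ) ^ (q * (nk + m)) * (-1) ^ (np + m) *
      (-1) ^ (r * (q + m) + q + nk * n + q * m) =
      (-1) ^ (r * nk + r * (q + m)) * (-1) ^ (np + nt) := by
    rw [← pow_add, ← pow_add, ← pow_add, H.card_t]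
    nth_rewrite 2 [H.card_r]
    rw [show q * (nk + m) + (np + m) + (r * (q + m) + q + nk * n + q * m) =
      (q + n) * nk + r * (q + m) + (np + (q + m)) + 2 * (q * m) by ring, pow_add _ _ (2 * _),
      pow_mul _ 2, neg_one_sq, one_pow, mul_one]
  unfold Ffun
  rw [hS]
  have regroup : ∀ {E Q N N' c S T W X Y Z G D D' D₁ D₁' V V' : ℂ},
      D * V = D' * V' → E * D₁ = X * G * W * D₁' → Z * T = Y → Q * N * X = Y * N' →
      E * Q * (N * c * S * D * D₁ * V) = G * Z * W * (N' * c * (T * S) * D' * D₁' * V') := by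
    intro E Q N N' c S T W X Y Z G D D' D₁ D₁' V V' h1 h2 h3 h4
    linear_combination Q * N * c * S * D * V * h2 + Q * N * c * S * X * G * W * D₁' * h1 +
      c * S * G * W * D₁' * D' * V' * h4 - c * S * G * W * D₁' * D' * V' * N' * h3
  exact regroup hDv hD'' hs hpar

end IsTranslate

theorem prod_split {n q m : ℕ} (hn : n = q + m) (g : Fin n → ℂ) :
    ∏ i, g i = (∏ i : Fin q, g ⟨i, by omega⟩) * ∏ i : Fin m, g ⟨q + i, by omega⟩ := by
  subst hn
  exact Fin.prod_univ_add g

theorem lt_card_filter_iff {n : ℕ} {t : Fin n → ℕ} (ht : StrictMono t) (r : ℕ) (i : Fin n) :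
    (i : ℕ) < (univ.filter fun a => t a ≤ r).card ↔ t i ≤ r := by
  constructor
  · intro hi
    by_contra hr
    have : (univ.filter fun a => t a ≤ r) ⊆ Iio i := by
      intro a ha
      have := (mem_filter.1 ha).2
      rw [mem_Iio, ← ht.lt_iff_lt]
      omega
    have := card_le_card this
    rw [Fin.card_Iio] at this
    omega
  · intro hr
    have : Iic i ⊆ (univ.filter fun a => t a ≤ r) := by
      intro a ha
      have := ht.monotone (mem_Iic.1 ha)
      exact mem_filter.2 ⟨mem_univ _, this.trans hr⟩
    have := card_le_card this
    rw [Fin.card_Iic] at this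
    omega

theorem isTranslate_append {r nk nt q : ℕ} {k : Fin nk → ℕ} {t : Fin nt → ℕ}
    (htm : StrictMono t) (hk0 : ∀ a, 0 < k a) (ht0 : ∀ a, 0 < t a)
    (hqdef : q = (Finset.univ.filter fun a : Fin nt => t a ≤ r).card) (hqle : q ≤ nt)
    {ttil : Fin (r - q) → ℕ}
    (httil_img : Finset.image ttil Finset.univ =
      Finset.Icc 1 r \
        Finset.image (fun a => r + 1 - t a) (Finset.univ.filter fun a : Fin nt => t a ≤ r))
    (σ : Equiv.Perm (Fin r))
    (hσ : ∀ j : Fin r, (σ j : ℕ) + 1 =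
      if hj : (j : ℕ) < q then r + 1 - t ⟨q - 1 - (j : ℕ), by omega⟩
      else ttil ⟨r - 1 - (j : ℕ), by have := j.isLt; omega⟩) :
    IsTranslate r (fun i : Fin q => t ⟨i, by omega⟩) ttil k t (Fin.append ttil fun a => k a + r)
      (fun a : Fin (nt - q) => t ⟨q + (a : ℕ), by have := a.isLt; omega⟩ - r)
      ((Equiv.Perm.sign σ : ℤ) : ℂ) := by
  have hlt : ∀ i : Fin nt, (i : ℕ) < q ↔ t i ≤ r := by
    rw [hqdef]
    exact lt_card_filter_iff htm r
  have hqr : q ≤ r := by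
    have := card_le_card_of_injOn (s := univ.filter fun a : Fin nt => t a ≤ r) (t := Icc 1 r) t
      (fun a ha => by
        have := (mem_filter.1 ha).2
        have := ht0 a
        simp; omega) htm.injective.injOn
    rw [Nat.card_Icc] at this
    omega
  have hr : r = q + (r - q) := by omega
  have hnt : nt = q + (nt - q) := by omega
  have hmem : ∀ i, ttil i ∈ Finset.Icc 1 r \
      Finset.image (fun a => r + 1 - t a) (Finset.univ.filter fun a : Fin nt => t a ≤ r) := by
    intro i
    rw [← httil_img]
    exact mem_image_of_mem _ (mem_univ _)
  have ht' : ∀ a : Fin (nt - q), r < t ⟨q + (a : ℕ), by have := a.isLt; omega⟩ := by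
    intro a
    have := (hlt ⟨q + (a : ℕ), by have := a.isLt; omega⟩).not.1 (by simp)
    omega
  have ht₁ : ∀ i : Fin q, t ⟨i, by omega⟩ ≤ r := fun i => (hlt _).1 i.isLt
  have hσ1 : ∀ i : Fin q, (σ ⟨i, by omega⟩ : ℕ) + 1 = r + 1 - t ⟨Fin.rev i, by omega⟩ := by
    intro i
    rw [hσ, dif_pos i.isLt]
    congr 3
    simp only [Fin.val_rev]
    omega
  have hσ2 : ∀ i : Fin (r - q), (σ ⟨q + i, by omega⟩ : ℕ) + 1 = ttil (Fin.rev i) := by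
    intro i
    rw [hσ, dif_neg (by simp)]
    congr 1
    ext
    simp only [Fin.val_rev]
    omega
  have hrev : ∀ {n : ℕ} (f : Fin n → ℂ), ∏ i, f (Fin.rev i) = ∏ i, f i := fun f =>
    Equiv.prod_comp Fin.revPerm f
  refine ⟨hr, hnt, fun i => ht0 _, ht₁, fun i j hij => ?_, fun i => ?_, fun j i hji => ?_,
    hk0, fun i => ?_, fun f => ?_, fun f => ?_, fun f => ?_, ?_, ?_, ?_, ?_⟩
  · have := htm.injective hij
    simp only [Fin.mk.injEq] at this
    exact Fin.ext this
  · exact (mem_Icc.1 (mem_sdiff.1 (hmem i)).1).1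
  · exact (mem_sdiff.1 (hmem j)).2 (mem_image.2
      ⟨⟨i, by omega⟩, mem_filter.2 ⟨mem_univ _, ht₁ i⟩, hji.symm⟩)
  · have := ht' i
    omega
  · simp [Fin.prod_univ_add]
  · rw [prod_split hnt]
    congr 1
    refine prod_congr rfl fun a _ => ?_
    rw [Nat.sub_add_cancel (ht' a).le]
  · rw [← Fin.prod_univ_eq_prod_range (fun j => f (j + 1)), ← Equiv.prod_comp σ, prod_split hr]
    simp only [hσ1, hσ2]
    rw [hrev fun i => f (ttil i), hrev fun i : Fin q => f (r + 1 - t ⟨i, by omega⟩)]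
  · rw [diffProd_split rfl]
    congr 1
    · congr 1
      · congr 1
        funext i
        exact congrArg _ (Fin.append_left ttil _ i)
      · unfold diffProd
        refine prod_congr rfl fun a _ => prod_congr rfl fun b _ => ?_
        have := fun a => Fin.append_right ttil (fun a => k a + r) a
        simp only [Fin.natAdd] at this
        simp only [this]
        push_cast
        ring
    · refine prod_congr rfl fun a _ => prod_congr rfl fun b _ => ?_
      have h1 := Fin.append_right ttil (fun a => k a + r) a
      have h2 := Fin.append_left ttil (fun a => k a + r) b
      simp only [Fin.natAdd] at h1
      rw [h1]
      congr 1
      · exact congrArg _ h2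
      · push_cast
        ring
  · rw [diffProd_split hnt]
    have hc : ∀ a : Fin (nt - q), ((t ⟨q + (a : ℕ), by have := a.isLt; omega⟩ - r : ℕ) : ℂ) =
        (t ⟨q + (a : ℕ), by have := a.isLt; omega⟩ : ℂ) - r := fun a => Nat.cast_sub (ht' a).le
    simp only [hc, sub_add_cancel]
    congr 2
    unfold diffProd
    exact prod_congr rfl fun a _ => prod_congr rfl fun b _ => by ring
  · rcases Int.units_eq_one_or (Equiv.Perm.sign σ) with h | h <;> simp [h]
  · rw [← diffProd_rev_nat, ← diffProd_perm, diffProd_split hr]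
    have hc1 : ∀ i : Fin q, ((σ ⟨i, by omega⟩ : ℕ) : ℂ) + 1 =
        r + 1 - t ⟨Fin.rev i, by omega⟩ := by
      intro i
      have h1 := ht₁ (Fin.rev i)
      have h2 : (σ ⟨i, by omega⟩ : ℕ) + 1 + t ⟨Fin.rev i, by omega⟩ = r + 1 := by
        rw [hσ1]; omega
      have h3 : (((σ ⟨i, by omega⟩ : ℕ) + 1 + t ⟨Fin.rev i, by omega⟩ : ℕ) : ℂ) =
        ((r + 1 : ℕ) : ℂ) := by rw [h2]
      push_cast at h3
      linear_combination h3
    have hc2 : ∀ i : Fin (r - q), ((σ ⟨q + i, by omega⟩ : ℕ) : ℂ) + 1 = ttil (Fin.rev i) := by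
      intro i
      exact_mod_cast hσ2 i
    simp only [Function.comp_apply, hc1, hc2]
    congr 1
    · congr 1
      · unfold diffProd
        exact prod_congr rfl fun a _ => prod_congr rfl fun b _ => by ring
      · rw [diffProd_rev fun i => -(ttil i : ℂ), diffProd, prod_prod_Iio_comm]
        exact prod_congr rfl fun a _ => prod_congr rfl fun b _ => by ring
    · rw [← hrev]
      refine prod_congr rfl fun a _ => ?_
      rw [Fin.rev_rev, ← hrev]
      refine prod_congr rfl fun b _ => ?_
      simp only [Fin.rev_rev]
      ring

/-- the discrete form factor evaluated at the `r`-translate `(k',t')` of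
`(k,t)` equals, up to the explicit sign and normalisation factors, the discrete form
factor of `(k,t)` at shifted parameter `ν - r`. -/
theorem stmt13 (r np nh nk nt : ℕ) (ν ω : ℂ)
    (hν : ∀ j : ℤ, ν ≠ (j : ℂ)) (hω : ω ≠ 0)
    (p : Fin np → ℕ) (h : Fin nh → ℕ) (k : Fin nk → ℕ) (t : Fin nt → ℕ)
    (hpm : StrictMono p) (hhm : StrictMono h) (hkm : StrictMono k) (htm : StrictMono t)
    (hp0 : ∀ a, 0 < p a) (hh0 : ∀ a, 0 < h a) (hk0 : ∀ a, 0 < k a) (ht0 : ∀ a, 0 < t a)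
    (q : ℕ) (hqdef : q = (Finset.univ.filter fun a : Fin nt => t a ≤ r).card)
    (hqle : q ≤ nt)
    (ttil : Fin (r - q) → ℕ) (httil : StrictMono ttil)
    (httil_img : Finset.image ttil Finset.univ =
      Finset.Icc 1 r \
        Finset.image (fun a => r + 1 - t a) (Finset.univ.filter fun a : Fin nt => t a ≤ r))
    (σ : Equiv.Perm (Fin r))
    (hσ : ∀ j : Fin r, (σ j : ℕ) + 1 =
      if hj : (j : ℕ) < q then r + 1 - t ⟨q - 1 - (j : ℕ), by omega⟩
      else ttil ⟨r - 1 - (j : ℕ), by have := j.isLt; omega⟩) :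
    (((Equiv.Perm.sign σ : ℤ) : ℂ)) * (-1 : ℂ) ^ (q * (nk + nt - q)) *
        Ffun p h (Fin.append ttil fun a => k a + r)
          (fun a : Fin (nt - q) => t ⟨q + (a : ℕ), by have := a.isLt; omega⟩ - r) ν ω
    = (∏ j ∈ Finset.range r, Complex.Gamma (1 + (j : ℂ) - ν)) *
        (-1 : ℂ) ^ ((r : ℤ) * ((nk : ℤ) + (nh : ℤ) - (np : ℤ) - (nt : ℤ))) *
        ω ^ (-(((r : ℤ) * ((r : ℤ) - 1)) / 2) - (r : ℤ) * ((nk : ℤ) - (nt : ℤ))) *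
        Ffun p h k t (ν - (r : ℂ)) ω := by
  have H := isTranslate_append (k := k) htm hk0 ht0 hqdef hqle httil_img σ hσ
  rw [show nk + nt - q = nk + (nt - q) by omega]
  exact H.Ffun_eq p h hν hω
end
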